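/- arXiv:0812.4102 — 3 statements merged into one kernel-verified Lean document; each statement's English description precedes it below -/
import Mathlib

section
/- The quantile function q belongs to C[0,∞) ∩ C^∞(0,∞) and satisfies the ODE q'(t) = −∂_x u(q(t),t) / (2 u(q(t),t)) for all t > 0. -/
open MeasureTheory Real Set Filter

/-- The Gaussian heat kernel `p(t,x,y) = (2πt)^{-1/2} exp(-(x-y)²/(2t))`. -/
noncomputable def heatKernel (t x y : ℝ) : ℝ :=
  (Real.sqrt (2 * Real.pi * t))⁻¹ * Real.exp (-(x - y) ^ 2 / (2 * t))

/-- The density `u(x,t)` of `B(t)`: `f` evolved by the heat semigroup. -/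
noncomputable def udens (f : ℝ → ℝ) (x t : ℝ) : ℝ :=
  if t = 0 then f x else ∫ y : ℝ, heatKernel t x y * f y

open ProbabilityTheory Topology

/-- The integral of `z ^ n * K (x - s * z)` against the standard Gaussian measure,
as a function of `(s, x)`. -/
noncomputable def gaussianAverage (K : ℝ → ℝ) (n : ℕ) (p : ℝ × ℝ) : ℝ :=
  ∫ z, z ^ n * K (p.2 - p.1 * z) ∂gaussianReal 0 1

/-- `K (n + 1)` is the derivative of `K n`, and every `K n` is bounded. -/
structure IsBoundedDerivSeq (K : ℕ → ℝ → ℝ) : Prop where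
  hasDerivAt : ∀ n x, HasDerivAt (K n) (K (n + 1) x) x
  bounded : ∀ n, ∃ B, ∀ x, ‖K n x‖ ≤ B

namespace IsBoundedDerivSeq

variable {K : ℕ → ℝ → ℝ}

lemma continuous (hK : IsBoundedDerivSeq K) (n : ℕ) : Continuous (K n) :=
  continuous_iff_continuousAt.2 fun x => (hK.hasDerivAt n x).continuousAt

lemma tail (hK : IsBoundedDerivSeq K) : IsBoundedDerivSeq fun n => K (n + 1) :=
  ⟨fun n => hK.hasDerivAt (n + 1), fun n => hK.bounded (n + 1)⟩

end IsBoundedDerivSeq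

lemma integrable_pow_gaussianReal (n : ℕ) :
    Integrable (fun z : ℝ => z ^ n) (gaussianReal 0 1) := by
  have h := (memLp_id_gaussianReal (μ := 0) (v := 1) (n : NNReal)).integrable_norm_pow'
  refine (integrable_norm_iff (by fun_prop)).1 ?_
  simpa using h

lemma integrable_pow_mul_gaussianReal {g : ℝ → ℝ} (hg : Continuous g) {B : ℝ}
    (hB : ∀ x, ‖g x‖ ≤ B) (n : ℕ) :
    Integrable (fun z : ℝ => z ^ n * g z) (gaussianReal 0 1) :=
  (integrable_pow_gaussianReal n).mul_bdd hg.aestronglyMeasurable (ae_of_all _ hB)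

lemma hasFDerivAt_gaussianAverage {K K' : ℝ → ℝ} (hK : ∀ x, HasDerivAt K (K' x) x)
    (hK' : Continuous K') {B B' : ℝ} (hB : ∀ x, ‖K x‖ ≤ B) (hB' : ∀ x, ‖K' x‖ ≤ B')
    (n : ℕ) (p : ℝ × ℝ) :
    HasFDerivAt (gaussianAverage K n)
      (gaussianAverage K' n p • ContinuousLinearMap.snd ℝ ℝ ℝ
        - gaussianAverage K' (n + 1) p • ContinuousLinearMap.fst ℝ ℝ ℝ) p := by
  have hKc : Continuous K := continuous_iff_continuousAt.2 fun x => (hK x).continuousAt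
  set F' : ℝ × ℝ → ℝ → (ℝ × ℝ →L[ℝ] ℝ) := fun p z =>
    (z ^ n * K' (p.2 - p.1 * z)) • ContinuousLinearMap.snd ℝ ℝ ℝ
      - (z ^ (n + 1) * K' (p.2 - p.1 * z)) • ContinuousLinearMap.fst ℝ ℝ ℝ with hF'
  have hint : ∀ m, Integrable (fun z => z ^ m * K' (p.2 - p.1 * z)) (gaussianReal 0 1) :=
    fun m => integrable_pow_mul_gaussianReal (by fun_prop) (fun _ => hB' _) m
  have h := hasFDerivAt_integral_of_dominated_of_fderiv_le (𝕜 := ℝ) (μ := gaussianReal 0 1)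
    (F := fun (p : ℝ × ℝ) z => z ^ n * K (p.2 - p.1 * z)) (F' := F') (x₀ := p) (s := univ)
    (bound := fun z => ‖z ^ n‖ * B' + ‖z ^ (n + 1)‖ * B') univ_mem
    (Eventually.of_forall fun p => (by fun_prop : Continuous _).aestronglyMeasurable)
    (integrable_pow_mul_gaussianReal (by fun_prop) (fun _ => hB _) n)
    (by
      have : Continuous (F' p) := by fun_prop
      exact this.aestronglyMeasurable)
    (ae_of_all _ fun z p _ => by
      refine (norm_sub_le _ _).trans ?_
      rw [norm_smul, norm_smul, norm_mul, norm_mul]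
      have h1 := ContinuousLinearMap.norm_fst_le ℝ ℝ ℝ
      have h2 := ContinuousLinearMap.norm_snd_le ℝ ℝ ℝ
      have h3 := hB' (p.2 - p.1 * z)
      have h4 := (norm_nonneg _).trans h3
      have aux : ∀ a c d : ℝ, 0 ≤ a → 0 ≤ c → 0 ≤ d → c ≤ B' → d ≤ 1 → a * c * d ≤ a * B' := by
        intro a c d ha hc hd hcB hd1
        calc a * c * d ≤ a * c * 1 := by gcongr
          _ ≤ a * B' := by rw [mul_one]; gcongr
      exact add_le_add (aux _ _ _ (norm_nonneg _) (norm_nonneg _) (norm_nonneg _) h3 h2)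
        (aux _ _ _ (norm_nonneg _) (norm_nonneg _) (norm_nonneg _) h3 h1))
    (((integrable_pow_gaussianReal n).norm.mul_const _).add
      ((integrable_pow_gaussianReal (n + 1)).norm.mul_const _))
    (ae_of_all _ fun z p _ => by
      have hin : HasFDerivAt (fun p : ℝ × ℝ => p.2 - p.1 * z)
          (ContinuousLinearMap.snd ℝ ℝ ℝ - z • ContinuousLinearMap.fst ℝ ℝ ℝ) p :=
        hasFDerivAt_snd.sub (hasFDerivAt_fst.mul_const z)
      refine (((hK _).comp_hasFDerivAt p hin).const_mul (z ^ n)).congr_fderiv ?_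
      ext
      · simp [hF']
        ring
      · simp [hF'])
  refine h.congr_fderiv ?_
  rw [hF', integral_sub ((hint n).smul_const _) ((hint (n + 1)).smul_const _),
    integral_smul_const, integral_smul_const]
  rfl

lemma IsBoundedDerivSeq.hasFDerivAt_gaussianAverage {K : ℕ → ℝ → ℝ} (hK : IsBoundedDerivSeq K)
    (n : ℕ) (p : ℝ × ℝ) :
    HasFDerivAt (gaussianAverage (K 0) n)
      (gaussianAverage (K 1) n p • ContinuousLinearMap.snd ℝ ℝ ℝ
        - gaussianAverage (K 1) (n + 1) p • ContinuousLinearMap.fst ℝ ℝ ℝ) p := by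
  obtain ⟨B, hB⟩ := hK.bounded 0
  obtain ⟨B', hB'⟩ := hK.bounded 1
  exact _root_.hasFDerivAt_gaussianAverage (hK.hasDerivAt 0) (hK.continuous 1) hB hB' n p

lemma IsBoundedDerivSeq.hasDerivAt_gaussianAverage {K : ℕ → ℝ → ℝ} (hK : IsBoundedDerivSeq K)
    (n : ℕ) (s x : ℝ) :
    HasDerivAt (fun x => gaussianAverage (K 0) n (s, x)) (gaussianAverage (K 1) n (s, x)) x := by
  have h := (hK.hasFDerivAt_gaussianAverage n (s, x)).comp_hasDerivAt x
    ((hasDerivAt_const x s).prodMk (hasDerivAt_id x))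
  simpa using! h

lemma IsBoundedDerivSeq.contDiff_gaussianAverage {K : ℕ → ℝ → ℝ} (hK : IsBoundedDerivSeq K)
    (n : ℕ) : ContDiff ℝ (⊤ : ℕ∞) (gaussianAverage (K 0) n) := by
  refine contDiff_infty.2 fun m => ?_
  induction m generalizing K n with
  | zero =>
    refine contDiff_zero.2 (continuous_iff_continuousAt.2 fun p => ?_)
    exact (hK.hasFDerivAt_gaussianAverage n p).continuousAt
  | succ m ih =>
    refine contDiff_succ_iff_hasFDerivAt.2 ⟨_, ?_, hK.hasFDerivAt_gaussianAverage n⟩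
    exact ((ih hK.tail n).smul contDiff_const).sub ((ih hK.tail (n + 1)).smul contDiff_const)

lemma integrable_gaussianPDFReal_mul {g : ℝ → ℝ} (hg : Integrable g (gaussianReal 0 1)) :
    Integrable fun z => gaussianPDFReal 0 1 z * g z := by
  rw [gaussianReal_of_var_ne_zero _ one_ne_zero, integrable_withDensity_iff_integrable_smul'
    (measurable_gaussianPDF _ _) (ae_of_all _ fun _ => gaussianPDF_lt_top)] at hg
  simpa using hg

lemma hasDerivAt_gaussianPDFReal (z : ℝ) :
    HasDerivAt (gaussianPDFReal 0 1) (-(z * gaussianPDFReal 0 1 z)) z := by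
  rw [gaussianPDFReal_def]
  have h : HasDerivAt (fun z : ℝ => -(z - 0) ^ 2 / (2 * ((1 : NNReal) : ℝ))) (-z) z := by
    have := (((hasDerivAt_id z).sub_const 0).pow 2).neg.div_const (2 * ((1 : NNReal) : ℝ))
    refine this.congr_deriv ?_
    simp
    ring
  refine (h.exp.const_mul _).congr_deriv ?_
  ring

/-- Gaussian integration by parts. -/
lemma gaussianAverage_one_eq {K K' : ℝ → ℝ} (hK : ∀ x, HasDerivAt K (K' x) x)
    (hK' : Continuous K') {B B' : ℝ} (hB : ∀ x, ‖K x‖ ≤ B) (hB' : ∀ x, ‖K' x‖ ≤ B')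
    (s x : ℝ) : gaussianAverage K 1 (s, x) = -s * gaussianAverage K' 0 (s, x) := by
  have hKc : Continuous K := continuous_iff_continuousAt.2 fun x => (hK x).continuousAt
  have i1 := integrable_gaussianPDFReal_mul (integrable_pow_mul_gaussianReal
    (g := fun z => K (x - s * z)) (by fun_prop) (fun _ => hB _) 1)
  have i0 := integrable_gaussianPDFReal_mul (integrable_pow_mul_gaussianReal
    (g := fun z => K (x - s * z)) (by fun_prop) (fun _ => hB _) 0)
  have i0' := integrable_gaussianPDFReal_mul (integrable_pow_mul_gaussianReal
    (g := fun z => K' (x - s * z)) (by fun_prop) (fun _ => hB' _) 0)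
  have h := integral_eq_zero_of_hasDerivAt_of_integrable
    (f := fun z => gaussianPDFReal 0 1 z * (z ^ 0 * K (x - s * z)))
    (f' := fun z => -(gaussianPDFReal 0 1 z * (z ^ 1 * K (x - s * z)))
      + (-s) * (gaussianPDFReal 0 1 z * (z ^ 0 * K' (x - s * z))))
    (fun z => by
      have hin : HasDerivAt (fun z : ℝ => x - s * z) (-s) z := by
        simpa using ((hasDerivAt_id z).const_mul s).const_sub x
      have := (hasDerivAt_gaussianPDFReal z).mul ((hK (x - s * z)).comp z hin)
      simp only [pow_zero, one_mul, pow_one]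
      refine this.congr_deriv ?_
      simp only [Function.comp_apply]
      ring)
    (i1.neg.add (i0'.const_mul _)) i0
  rw [integral_add (by exact i1.neg) (i0'.const_mul _), integral_neg, integral_const_mul] at h
  simp only [gaussianAverage, integral_gaussianReal_eq_integral_smul one_ne_zero, smul_eq_mul]
  linarith

lemma gaussianAverage_zero_eq_udens (f : ℝ → ℝ) {s : ℝ} (hf : Continuous f) (x : ℝ) :
    gaussianAverage f 0 (s, x) = udens f x (s ^ 2) := by
  rcases eq_or_ne s 0 with rfl | hs
  · simp [gaussianAverage, udens]
  have hv : NNReal.mk (s ^ 2) (sq_nonneg s) ≠ 0 := by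
    intro h; exact pow_ne_zero 2 hs (congrArg NNReal.toReal h)
  have hmap : (gaussianReal 0 1).map (fun z => x - s * z)
      = gaussianReal x (NNReal.mk (s ^ 2) (sq_nonneg s)) := by
    rw [show (fun z => x - s * z) = (fun z => x - z) ∘ (fun z => s * z) from rfl,
      ← Measure.map_map (by fun_prop) (by fun_prop), gaussianReal_map_const_mul,
      gaussianReal_map_const_sub]
    simp
  have : ∫ z, f (x - s * z) ∂gaussianReal 0 1
      = ∫ y, f y ∂gaussianReal x (NNReal.mk (s ^ 2) (sq_nonneg s)) := by
    rw [← hmap, integral_map (by fun_prop) hf.aestronglyMeasurable]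
  simp only [gaussianAverage, pow_zero, one_mul, udens, pow_ne_zero 2 hs, if_false]
  rw [this, integral_gaussianReal_eq_integral_smul hv]
  congr 1 with y
  simp only [gaussianPDFReal, heatKernel, smul_eq_mul, NNReal.coe_mk]
  rw [show -(y - x) ^ 2 = -(x - y) ^ 2 by ring]

lemma gaussianAverage_pos {g : ℝ → ℝ} (hg : Continuous g) {B : ℝ} (hB : ∀ x, ‖g x‖ ≤ B)
    (h0 : ∀ x, 0 ≤ g x) {s x z : ℝ} (hz : 0 < g (x - s * z)) :
    0 < gaussianAverage g 0 (s, x) := by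
  have : (gaussianReal 0 1).IsOpenPosMeasure :=
    (gaussianReal_absolutelyContinuous' 0 one_ne_zero).isOpenPosMeasure
  have hint := integrable_pow_mul_gaussianReal
    (g := fun z => g (x - s * z)) (by fun_prop) (fun _ => hB _) 0
  refine integral_pos_of_integrable_nonneg_nonzero (x := z) (by fun_prop) hint ?_ ?_
  · intro z; simpa using h0 _
  · simpa using hz.ne'

/-- The distribution function of a Schwartz density, followed by its successive derivatives. -/
noncomputable def cdfDerivSeq (f : SchwartzMap ℝ ℝ) : ℕ → ℝ → ℝ
  | 0 => fun r => ∫ x in Iic r, f x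
  | n + 1 => ⇑((⇑(SchwartzMap.derivCLM ℝ ℝ))^[n] f)

lemma isBoundedDerivSeq_cdfDerivSeq (f : SchwartzMap ℝ ℝ) :
    IsBoundedDerivSeq (cdfDerivSeq f) where
  hasDerivAt n x := by
    cases n with
    | zero =>
      have h : cdfDerivSeq f 0 = fun r => (∫ y in Iic 0, f y) + ∫ y in (0 : ℝ)..r, f y := by
        ext r
        rw [← intervalIntegral.integral_Iic_sub_Iic f.integrable.integrableOn
          f.integrable.integrableOn]
        simp [cdfDerivSeq]
      rw [h]
      exact (intervalIntegral.integral_hasDerivAt_right (f.integrable.intervalIntegrable)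
        f.continuous.stronglyMeasurable.stronglyMeasurableAtFilter
        f.continuous.continuousAt).const_add _
    | succ n =>
      simp only [cdfDerivSeq, Function.iterate_succ_apply', SchwartzMap.derivCLM_apply]
      exact (SchwartzMap.differentiableAt _).hasDerivAt
  bounded n := by
    cases n with
    | zero =>
      refine ⟨∫ x, ‖f x‖, fun r => ?_⟩
      refine (norm_integral_le_integral_norm _).trans ?_
      exact setIntegral_le_integral f.integrable.norm (ae_of_all _ fun _ => norm_nonneg _)
    | succ n =>
      set g := (⇑(SchwartzMap.derivCLM ℝ ℝ))^[n] f
      obtain ⟨C, -, hC⟩ := g.decay 0 0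
      exact ⟨C, fun x => by simpa [cdfDerivSeq] using hC x⟩

lemma tendsto_gaussianAverage_atBot {K : ℝ → ℝ} (hK : Continuous K) {B : ℝ}
    (hB : ∀ x, ‖K x‖ ≤ B) (h0 : Tendsto K atBot (𝓝 0)) (s : ℝ) :
    Tendsto (fun x => gaussianAverage K 0 (s, x)) atBot (𝓝 0) := by
  have h := tendsto_integral_filter_of_dominated_convergence (μ := gaussianReal 0 1)
    (F := fun (x : ℝ) z => z ^ 0 * K (x - s * z)) (f := fun _ => 0) (l := atBot) (fun _ => B)
    (Eventually.of_forall fun x => (by fun_prop : Continuous _).aestronglyMeasurable)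
    (Eventually.of_forall fun x => ae_of_all _ fun z => by simpa using hB _)
    (integrable_const _)
    (ae_of_all _ fun z => by
      simpa [sub_eq_add_neg, Function.comp_def] using
        h0.comp (tendsto_atBot_add_const_right _ (-(s * z)) tendsto_id))
  simpa [gaussianAverage] using h

lemma setIntegral_Iic_of_hasDerivAt_of_nonneg {G g : ℝ → ℝ} (hG : ∀ x, HasDerivAt G (g x) x)
    (hg : Continuous g) (h0 : ∀ x, 0 ≤ g x) (hlim : Tendsto G atBot (𝓝 0)) (r : ℝ) :
    ∫ x in Iic r, g x = G r := by
  have hint : IntegrableOn g (Iic r) := by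
    refine integrableOn_Iic_of_intervalIntegral_norm_tendsto (l := atBot) (a := id) (G r) r
      (fun i => hg.integrableOn_Ioc) tendsto_id ?_
    have : ∀ i, ∫ x in i..r, ‖g x‖ = G r - G i := fun i => by
      simp only [Real.norm_of_nonneg (h0 _)]
      exact intervalIntegral.integral_eq_sub_of_hasDerivAt (fun x _ => hG x)
        (hg.intervalIntegrable _ _)
    simp only [id, this]
    simpa using hlim.const_sub (G r)
  simpa using integral_Iic_of_hasDerivAt_of_tendsto' (fun x _ => hG x) hint hlim

lemma setIntegral_Iic_udens (f : SchwartzMap ℝ ℝ) (hf : ∀ x, 0 ≤ f x) (s r : ℝ) :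
    ∫ x in Iic r, udens f x (s ^ 2) = gaussianAverage (cdfDerivSeq f 0) 0 (s, r) := by
  have hK := isBoundedDerivSeq_cdfDerivSeq f
  obtain ⟨B, hB⟩ := hK.bounded 0
  simp only [← gaussianAverage_zero_eq_udens f f.continuous]
  refine setIntegral_Iic_of_hasDerivAt_of_nonneg
    (G := fun r => gaussianAverage (cdfDerivSeq f 0) 0 (s, r))
    (hK.hasDerivAt_gaussianAverage 0 s)
    ((hK.tail.contDiff_gaussianAverage 0).continuous.comp (by fun_prop : Continuous (Prod.mk s)))
    (fun x => integral_nonneg fun z => by simpa using! hf _)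
    (tendsto_gaussianAverage_atBot (hK.continuous 0) hB ?_ s) r
  exact tendsto_integral_Iic_zero tendsto_id

/-- The implicit function theorem in the plane: near a point where `∂ᵣG = b ≠ 0` and `∂ₛG = -a`,
the level set of `G` contains the graph of a smooth function with slope `a / b`. -/
lemma exists_contDiffAt_implicit {G : ℝ × ℝ → ℝ} (hG : ContDiff ℝ (⊤ : ℕ∞) G) {a b s r : ℝ}
    (hd : HasFDerivAt G
      (b • ContinuousLinearMap.snd ℝ ℝ ℝ - a • ContinuousLinearMap.fst ℝ ℝ ℝ) (s, r))
    (hb : b ≠ 0) :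
    ∃ h : ℝ → ℝ, ContDiffAt ℝ (⊤ : ℕ∞) h s ∧ h s = r ∧ HasDerivAt h (a / b) s ∧
      ∀ᶠ σ in 𝓝 s, G (σ, h σ) = G (s, r) := by
  have hn : ((⊤ : ℕ∞) : WithTop ℕ∞) ≠ 0 := by simp
  have hinv : (fderiv ℝ G (s, r) ∘L .inr ℝ ℝ ℝ).IsInvertible := by
    refine ⟨ContinuousLinearEquiv.unitsEquivAut ℝ (Units.mk0 b hb), ?_⟩
    ext
    simp [hd.fderiv]
  set h := hG.contDiffAt.implicitFunction hn hinv
  have hs : h s = r := hG.contDiffAt.implicitFunction_apply_self hn hinv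
  have hc : ContDiffAt ℝ (⊤ : ℕ∞) h s := hG.contDiffAt.contDiffAt_implicitFunction hn hinv
  have he : ∀ᶠ σ in 𝓝 s, G (σ, h σ) = G (s, r) :=
    hG.contDiffAt.eventually_apply_implicitFunction hn hinv
  refine ⟨h, hc, hs, ?_, he⟩
  have hh := (hc.differentiableAt hn).hasDerivAt
  have h1 := HasFDerivAt.comp_hasDerivAt (l := G) (f := fun σ => (σ, h σ)) s (by rw [hs]; exact hd)
    ((hasDerivAt_id s).prodMk hh)
  have h2 := h1.unique ((hasDerivAt_const s (G (s, r))).congr_of_eventuallyEq he)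
  simp at h2
  convert! hh using 1
  field_simp
  linarith

/-- The quantile function `q` is continuous on `[0,∞)`, smooth on `(0,∞)`,
and satisfies `q'(t) = -∂ₓu(q(t),t) / (2 u(q(t),t))` for all `t > 0`. -/
theorem quantile_ode
    (f : SchwartzMap ℝ ℝ) (hf_nonneg : ∀ x, 0 ≤ f x) (hf_prob : ∫ x : ℝ, f x = 1)
    (α : ℝ) (hα : α ∈ Set.Ioo (0 : ℝ) 1)
    (q : ℝ → ℝ)
    (hq : ∀ t, 0 ≤ t → ∫ x in Set.Iic (q t), udens (⇑f) x t = α)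
    (hq_unique : ∀ t, 0 ≤ t → ∀ r : ℝ, (∫ x in Set.Iic r, udens (⇑f) x t = α) → r = q t)
    (hfq0 : 0 < f (q 0)) :
    ContinuousOn q (Set.Ici 0) ∧ ContDiffOn ℝ (⊤ : ℕ∞) q (Set.Ioi 0) ∧
      ∀ t, 0 < t →
        HasDerivAt q (-(deriv (fun x => udens (⇑f) x t) (q t)) / (2 * udens (⇑f) (q t) t)) t := by
  have hK := isBoundedDerivSeq_cdfDerivSeq f
  obtain ⟨B₁, hB₁⟩ := hK.bounded 1
  obtain ⟨B₂, hB₂⟩ := hK.bounded 2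
  have hpos : ∀ t, 0 ≤ t → 0 < gaussianAverage f 0 (√t, q t) := by
    intro t ht
    refine gaussianAverage_pos (z := (q t - q 0) / √t) f.continuous hB₁ hf_nonneg ?_
    rcases ht.eq_or_lt with rfl | ht
    · simpa using hfq0
    · have : √t ≠ 0 := (Real.sqrt_pos.2 ht).ne'
      rwa [mul_div_cancel₀ _ this, sub_sub_cancel]
  have key : ∀ t, 0 ≤ t → ∃ h : ℝ → ℝ, ContDiffAt ℝ (⊤ : ℕ∞) h √t ∧
      HasDerivAt h (gaussianAverage f 1 (√t, q t) / gaussianAverage f 0 (√t, q t)) √t ∧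
      ∀ᶠ τ in 𝓝 t, 0 ≤ τ → q τ = h √τ := by
    intro t ht
    obtain ⟨h, hc, -, hd, he⟩ := exists_contDiffAt_implicit (hK.contDiff_gaussianAverage 0)
      (hK.hasFDerivAt_gaussianAverage 0 (√t, q t)) (hpos t ht).ne'
    refine ⟨h, hc, hd, ?_⟩
    filter_upwards [(Real.continuous_sqrt.tendsto t).eventually he] with τ hτ hτ0
    refine (hq_unique τ hτ0 _ ?_).symm
    have h1 := setIntegral_Iic_udens f hf_nonneg √τ (h √τ)
    have h2 := setIntegral_Iic_udens f hf_nonneg √t (q t)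
    rw [Real.sq_sqrt hτ0] at h1
    rw [Real.sq_sqrt ht, hq t ht] at h2
    rw [h1, hτ, h2]
  have key' : ∀ t, 0 < t → ∃ h : ℝ → ℝ, ContDiffAt ℝ (⊤ : ℕ∞) h √t ∧
      HasDerivAt h (gaussianAverage f 1 (√t, q t) / gaussianAverage f 0 (√t, q t)) √t ∧
      q =ᶠ[𝓝 t] h ∘ sqrt := by
    intro t ht
    obtain ⟨h, hc, hd, he⟩ := key t ht.le
    refine ⟨h, hc, hd, ?_⟩
    filter_upwards [he, lt_mem_nhds ht] with τ hτ hτ0 using hτ hτ0.le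
  refine ⟨fun t ht => ?_, fun t ht => ?_, fun t ht => ?_⟩
  · obtain ⟨h, hc, -, he⟩ := key t ht
    have hcont : ContinuousWithinAt (h ∘ sqrt) (Ici 0) t :=
      (ContinuousAt.comp hc.continuousAt Real.continuous_sqrt.continuousAt).continuousWithinAt
    exact hcont.congr_of_eventuallyEq (eventually_nhdsWithin_iff.2 he) (he.self_of_nhds ht)
  · obtain ⟨h, hc, -, he⟩ := key' t ht
    exact ((hc.comp t (Real.contDiffAt_sqrt (ne_of_gt ht))).congr_of_eventuallyEq
      he).contDiffWithinAt
  · obtain ⟨h, -, hd, he⟩ := key' t ht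
    have hst := Real.sqrt_pos.2 ht
    have hu : ∀ x, gaussianAverage f 0 (√t, x) = udens f x t := fun x => by
      rw [gaussianAverage_zero_eq_udens f f.continuous, Real.sq_sqrt ht.le]
    have hux : deriv (fun x => udens f x t) (q t)
        = gaussianAverage (cdfDerivSeq f 2) 0 (√t, q t) := by
      simp only [← hu]
      exact (hK.tail.hasDerivAt_gaussianAverage 0 √t (q t)).deriv
    have hparts : gaussianAverage f 1 (√t, q t)
        = -√t * gaussianAverage (cdfDerivSeq f 2) 0 (√t, q t) :=
      gaussianAverage_one_eq (hK.hasDerivAt 1) (hK.continuous 2) hB₁ hB₂ √t (q t)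
    have hp := hpos t ht.le
    refine ((hd.comp t (Real.hasDerivAt_sqrt ht.ne')).congr_of_eventuallyEq he).congr_deriv ?_
    rw [hux, hparts, ← hu]
    field_simp
end

section
/- For each T > 0 there exist positive constants δ, C_1, C_2 such that whenever 0 < s < t ≤ T and |t − s| < δ, the partial derivatives of ρ exist and satisfy: (i) C_1|t − s|^{-1/2} ≤ ∂_s ρ(s,t) ≤ C_2|t − s|^{-1/2}; (ii) −C_2|t − s|^{-1/2} ≤ ∂_t ρ(s,t) ≤ −C_1|t − s|^{-1/2}; (iii) −C_2|t − s|^{-3/2} ≤ ∂²_{st} ρ(s,t) ≤ −C_1|t − s|^{-3/2}. -/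
open MeasureTheory Real Set Filter

/-- The covariance function
`ρ(s,t) = (P(B(s) ≤ q(s), B(t) ≤ q(t)) − α²)/(u(q(s),s) u(q(t),t))`. -/
noncomputable def rho {Ω : Type*} [MeasurableSpace Ω] (P : Measure Ω)
    (B : ℝ → Ω → ℝ) (f : ℝ → ℝ) (q : ℝ → ℝ) (α s t : ℝ) : ℝ :=
  ((P {ω | B s ω ≤ q s ∧ B t ω ≤ q t}).toReal - α ^ 2) /
    (udens f (q s) s * udens f (q t) t)

open scoped Topology

/-! ### Cumulative integrals -/

theorem hasDerivAt_integral_Iic {g : ℝ → ℝ} (hg : Continuous g) (hgi : Integrable g) (w : ℝ) :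
    HasDerivAt (fun w => ∫ z in Iic w, g z) (g w) w := by
  have h :
      (fun w => ∫ z in Iic w, g z) = fun w => (∫ z in Iic 0, g z) + ∫ z in (0 : ℝ)..w, g z := by
    funext w
    rw [← intervalIntegral.integral_Iic_sub_Iic hgi.integrableOn hgi.integrableOn]
    ring
  rw [h]
  exact (intervalIntegral.integral_hasDerivAt_right (hg.intervalIntegrable _ _)
    (hg.stronglyMeasurableAtFilter _ _) hg.continuousAt).const_add _

theorem tendsto_integral_Iic_atBot {g : ℝ → ℝ} (hgi : Integrable g) :
    Tendsto (fun w => ∫ z in Iic w, g z) atBot (𝓝 0) := by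
  have h := (intervalIntegral_tendsto_integral_Iic (0 : ℝ) hgi.integrableOn tendsto_id)
  have h2 :
      (fun w => ∫ z in Iic w, g z) = fun w => (∫ z in Iic 0, g z) - ∫ z in w..(0 : ℝ), g z := by
    funext w
    rw [← intervalIntegral.integral_Iic_sub_Iic hgi.integrableOn hgi.integrableOn]
    ring
  rw [h2]
  simpa using h.const_sub (∫ z in Iic 0, g z)

/-! ### The standard Gaussian density, its distribution function, and the heat kernel -/

/-- The standard Gaussian density. -/
noncomputable def gaussDensity (z : ℝ) : ℝ := (√(2 * π))⁻¹ * exp (-z ^ 2 / 2)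

theorem gaussDensity_pos (z : ℝ) : 0 < gaussDensity z := by
  unfold gaussDensity; positivity

@[fun_prop]
theorem continuous_gaussDensity : Continuous gaussDensity := by
  unfold gaussDensity; fun_prop

theorem hasDerivAt_gaussDensity (z : ℝ) : HasDerivAt gaussDensity (-z * gaussDensity z) z := by
  have h : HasDerivAt (fun z : ℝ => -z ^ 2 / 2) (-z) z :=
    (((hasDerivAt_pow 2 z).neg).div_const 2).congr_deriv (by norm_num; ring)
  refine ((h.exp).const_mul (√(2 * π))⁻¹).congr_deriv ?_
  unfold gaussDensity
  ring

theorem inv_sqrt_two_pi_le_one : (√(2 * π))⁻¹ ≤ 1 := by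
  apply inv_le_one_of_one_le₀
  rw [Real.one_le_sqrt]
  linarith [pi_gt_three]

theorem gaussDensity_le (z : ℝ) : gaussDensity z ≤ (√(2 * π))⁻¹ := by
  unfold gaussDensity
  apply mul_le_of_le_one_right (by positivity)
  rw [exp_le_one_iff]
  nlinarith [sq_nonneg z]

theorem gaussDensity_le_one (z : ℝ) : gaussDensity z ≤ 1 :=
  (gaussDensity_le z).trans inv_sqrt_two_pi_le_one

theorem gaussDensity_mul_abs_le_one (z : ℝ) : gaussDensity z * |z| ≤ 1 := by
  have h1 : exp (-z ^ 2 / 2) * |z| ≤ 1 := by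
    have h2 : |z| ≤ exp (z ^ 2 / 2) := by
      have := add_one_le_exp (z ^ 2 / 2)
      nlinarith [sq_abs z, sq_nonneg (|z| - 1)]
    have h3 : exp (-z ^ 2 / 2) * exp (z ^ 2 / 2) = 1 := by
      rw [← exp_add]; simp [neg_div]
    calc _ ≤ exp (-z ^ 2 / 2) * exp (z ^ 2 / 2) := by gcongr
      _ = 1 := h3
  unfold gaussDensity
  rw [mul_assoc]
  exact mul_le_one₀ inv_sqrt_two_pi_le_one (by positivity) h1

private theorem gaussDensity_eq :
    gaussDensity = fun z => (√(2 * π))⁻¹ * exp (-(1 / 2) * z ^ 2) := by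
  funext z
  unfold gaussDensity
  congr 2
  ring

theorem integrable_gaussDensity : Integrable gaussDensity := by
  rw [gaussDensity_eq]
  exact (integrable_exp_neg_mul_sq (by norm_num)).const_mul _

theorem integral_gaussDensity : ∫ z, gaussDensity z = 1 := by
  rw [gaussDensity_eq, integral_const_mul, integral_gaussian]
  rw [show π / (1 / 2) = 2 * π by ring]
  exact inv_mul_cancel₀ (by positivity)

theorem integrable_mul_gaussDensity : Integrable fun z => z * gaussDensity z := by
  rw [gaussDensity_eq]
  have := (integrable_mul_exp_neg_mul_sq (b := 1 / 2) (by norm_num)).const_mul (√(2 * π))⁻¹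
  exact this.congr (ae_of_all _ fun z => by ring)

theorem integrable_abs_mul_gaussDensity : Integrable fun z => |z| * gaussDensity z := by
  refine integrable_mul_gaussDensity.abs.congr (ae_of_all _ fun z => ?_)
  simp [abs_mul, abs_of_pos (gaussDensity_pos z)]

theorem integrable_sq_mul_gaussDensity : Integrable fun z => z ^ 2 * gaussDensity z := by
  rw [gaussDensity_eq]
  have := (integrable_rpow_mul_exp_neg_mul_sq (b := 1 / 2) (s := 2) (by norm_num)
    (by norm_num)).const_mul (√(2 * π))⁻¹
  refine this.congr (ae_of_all _ fun z => ?_)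
  simp only [rpow_ofNat]
  ring

/-- The standard Gaussian distribution function. -/
noncomputable def gaussCdf (w : ℝ) : ℝ := ∫ z in Iic w, gaussDensity z

theorem hasDerivAt_gaussCdf (w : ℝ) : HasDerivAt gaussCdf (gaussDensity w) w :=
  hasDerivAt_integral_Iic continuous_gaussDensity integrable_gaussDensity w

@[fun_prop]
theorem continuous_gaussCdf : Continuous gaussCdf :=
  continuous_iff_continuousAt.2 fun w => (hasDerivAt_gaussCdf w).continuousAt

theorem abs_gaussCdf_le_one (w : ℝ) : |gaussCdf w| ≤ 1 := by
  have h0 : 0 ≤ gaussCdf w := integral_nonneg fun z => (gaussDensity_pos z).le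
  rw [abs_of_nonneg h0, ← integral_gaussDensity]
  exact setIntegral_le_integral integrable_gaussDensity
    (ae_of_all _ fun z => (gaussDensity_pos z).le)

/-- The centred Gaussian density with variance `τ`. -/
noncomputable def gaussKernel (τ d : ℝ) : ℝ := (√τ)⁻¹ * gaussDensity (d / √τ)

theorem gaussKernel_nonneg (τ d : ℝ) : 0 ≤ gaussKernel τ d :=
  mul_nonneg (by positivity) (gaussDensity_pos _).le

theorem gaussKernel_le (τ d : ℝ) : gaussKernel τ d ≤ (√τ)⁻¹ :=
  mul_le_of_le_one_right (by positivity) (gaussDensity_le_one _)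

theorem gaussKernel_mul_abs_le {τ : ℝ} (h : 0 < τ) (d : ℝ) :
    gaussKernel τ d * |d / τ| ≤ τ⁻¹ := by
  have hs : 0 < √τ := Real.sqrt_pos.2 h
  have e : gaussKernel τ d * |d / τ| = τ⁻¹ * (gaussDensity (d / √τ) * |d / √τ|) := by
    unfold gaussKernel
    have h3 : τ⁻¹ = (√τ)⁻¹ * (√τ)⁻¹ := by rw [← mul_inv, Real.mul_self_sqrt h.le]
    rw [abs_div, abs_div, abs_of_pos h, abs_of_pos hs]
    simp only [div_eq_mul_inv, h3]
    generalize gaussDensity _ = g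
    ring
  rw [e]
  exact mul_le_of_le_one_right (by positivity) (gaussDensity_mul_abs_le_one _)

theorem heatKernel_eq_gaussKernel {τ : ℝ} (hτ : 0 < τ) (x y : ℝ) :
    heatKernel τ x y = gaussKernel τ (y - x) := by
  unfold heatKernel gaussKernel gaussDensity
  rw [Real.sqrt_mul (by positivity), mul_inv, div_pow, Real.sq_sqrt hτ.le, ← mul_assoc,
    mul_comm (√(2 * π))⁻¹]
  congr 2
  field_simp
  ring

private theorem hasDerivAt_div_sqrt {d τ : ℝ → ℝ} {d' τ' s : ℝ} (hd : HasDerivAt d d' s)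
    (hτ : HasDerivAt τ τ' s) (hpos : 0 < τ s) :
    HasDerivAt (fun s => d s / √(τ s)) ((√(τ s))⁻¹ * (d' - d s * τ' / (2 * τ s))) s := by
  have h := hd.div (hτ.sqrt hpos.ne') (Real.sqrt_pos.2 hpos).ne'
  refine h.congr_deriv ?_
  have hs : 0 < √(τ s) := Real.sqrt_pos.2 hpos
  have h2 : τ s = √(τ s) ^ 2 := (Real.sq_sqrt hpos.le).symm
  generalize √(τ s) = r at *
  rw [h2]
  field_simp

theorem HasDerivAt.gaussCdf_div_sqrt {d τ : ℝ → ℝ} {d' τ' s : ℝ} (hd : HasDerivAt d d' s)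
    (hτ : HasDerivAt τ τ' s) (hpos : 0 < τ s) :
    HasDerivAt (fun s => gaussCdf (d s / √(τ s)))
      (gaussKernel (τ s) (d s) * (d' - d s * τ' / (2 * τ s))) s := by
  have h := (hasDerivAt_gaussCdf (d s / √(τ s))).comp s (hasDerivAt_div_sqrt hd hτ hpos)
  refine h.congr_deriv ?_
  unfold gaussKernel
  ring

theorem HasDerivAt.gaussKernel {d τ : ℝ → ℝ} {d' τ' s : ℝ} (hd : HasDerivAt d d' s)
    (hτ : HasDerivAt τ τ' s) (hpos : 0 < τ s) :
    HasDerivAt (fun s => gaussKernel (τ s) (d s))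
      (gaussKernel (τ s) (d s) *
        (-τ' / (2 * τ s) - d s * d' / τ s + d s ^ 2 * τ' / (2 * τ s ^ 2))) s := by
  have hs : 0 < √(τ s) := Real.sqrt_pos.2 hpos
  have h1 := (hasDerivAt_gaussDensity (d s / √(τ s))).comp s (hasDerivAt_div_sqrt hd hτ hpos)
  have h2 := ((hτ.sqrt hpos.ne').inv hs.ne').mul h1
  refine h2.congr_deriv ?_
  have h3 : τ s = √(τ s) ^ 2 := (Real.sq_sqrt hpos.le).symm
  simp only [_root_.gaussKernel, Function.comp_apply, Pi.inv_apply]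
  generalize √(τ s) = r at *
  rw [h3]
  field_simp
  ring

theorem integrable_gaussKernel {τ : ℝ} (hτ : 0 < τ) : Integrable (gaussKernel τ) :=
  (integrable_gaussDensity.comp_div (Real.sqrt_pos.2 hτ).ne').const_mul _

theorem integral_gaussKernel {τ : ℝ} (hτ : 0 < τ) : ∫ d, gaussKernel τ d = 1 := by
  have hs : 0 < √τ := Real.sqrt_pos.2 hτ
  unfold gaussKernel
  rw [integral_const_mul, Measure.integral_comp_div, integral_gaussDensity, abs_of_pos hs]
  simp [hs.ne']

theorem continuous_gaussKernel (τ : ℝ) : Continuous (gaussKernel τ) := by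
  unfold gaussKernel; fun_prop

theorem setIntegral_Iic_heatKernel {τ : ℝ} (hτ : 0 < τ) (x b : ℝ) :
    ∫ y in Iic b, heatKernel τ x y = gaussCdf ((b - x) / √τ) := by
  have hs : 0 < √τ := Real.sqrt_pos.2 hτ
  simp only [heatKernel_eq_gaussKernel hτ]
  have ht : Tendsto (fun y => gaussCdf ((y - x) / √τ)) atBot (𝓝 0) :=
    (tendsto_integral_Iic_atBot integrable_gaussDensity).comp
      ((tendsto_atBot_add_const_right _ (-x) tendsto_id).atBot_div_const hs)
  have := integral_Iic_of_hasDerivAt_of_tendsto' (a := b) (f' := fun y => gaussKernel τ (y - x))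
    (fun y _ => ?_) ((integrable_gaussKernel hτ).comp_sub_right x).integrableOn ht
  · simpa using this
  · have h := HasDerivAt.gaussCdf_div_sqrt ((hasDerivAt_id y).sub_const x)
      (hasDerivAt_const y τ) hτ
    simpa using h

/-! ### The heat semigroup as a Gaussian average -/

/-- The heat semigroup at time `t` applied to `h`, evaluated at `x`. -/
noncomputable def gaussAvg (h : ℝ → ℝ) (x t : ℝ) : ℝ := ∫ z, h (x + √t * z) * gaussDensity z

theorem udens_eq_gaussAvg (f : ℝ → ℝ) (x : ℝ) {t : ℝ} (ht : 0 ≤ t) :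
    udens f x t = gaussAvg f x t := by
  unfold udens gaussAvg
  rcases ht.eq_or_lt with rfl | ht
  · simp [integral_const_mul, integral_gaussDensity]
  have hs : 0 < √t := Real.sqrt_pos.2 ht
  rw [if_neg ht.ne']
  simp only [heatKernel_eq_gaussKernel ht]
  rw [← integral_add_right_eq_self _ x]
  have h := Measure.integral_comp_mul_left
    (fun w => gaussKernel t (w + x - x) * f (w + x)) (√t)
  rw [abs_of_pos (inv_pos.2 hs), smul_eq_mul, inv_mul_eq_div, eq_div_iff hs.ne'] at h
  rw [← h, ← integral_mul_const]
  congr 1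
  funext z
  simp only [gaussKernel, add_sub_cancel_right, mul_div_cancel_left₀ z hs.ne']
  rw [add_comm x]
  field_simp

/-- A `C²` function `h` with derivatives `h₁`, `h₂`, all three bounded by `C`. -/
structure BoundedC2 (h h₁ h₂ : ℝ → ℝ) (C : ℝ) : Prop where
  hasDerivAt : ∀ x, HasDerivAt h (h₁ x) x
  hasDerivAt' : ∀ x, HasDerivAt h₁ (h₂ x) x
  continuous_snd : Continuous h₂
  bound : ∀ x, |h x| ≤ C
  bound' : ∀ x, |h₁ x| ≤ C
  bound_snd : ∀ x, |h₂ x| ≤ C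

namespace BoundedC2

variable {h h₁ h₂ : ℝ → ℝ} {C : ℝ}

theorem continuous (H : BoundedC2 h h₁ h₂ C) : Continuous h :=
  continuous_iff_continuousAt.2 fun x => (H.hasDerivAt x).continuousAt

theorem continuous' (H : BoundedC2 h h₁ h₂ C) : Continuous h₁ :=
  continuous_iff_continuousAt.2 fun x => (H.hasDerivAt' x).continuousAt

theorem nonneg (H : BoundedC2 h h₁ h₂ C) : 0 ≤ C := (abs_nonneg _).trans (H.bound 0)

end BoundedC2

theorem integrable_comp_mul_gaussDensity {h : ℝ → ℝ} (hc : Continuous h) {C : ℝ}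
    (hb : ∀ x, |h x| ≤ C) (x t : ℝ) :
    Integrable fun z => h (x + √t * z) * gaussDensity z :=
  integrable_gaussDensity.bdd_mul (by fun_prop : Continuous _).aestronglyMeasurable
    (ae_of_all _ fun z => hb (x + √t * z))

theorem abs_gaussAvg_le {h : ℝ → ℝ} {C : ℝ} (hb : ∀ x, |h x| ≤ C) (x t : ℝ) :
    |gaussAvg h x t| ≤ C := by
  have := norm_integral_le_of_norm_le (integrable_gaussDensity.const_mul C)
    (f := fun z => h (x + √t * z) * gaussDensity z) (ae_of_all _ fun z => by
      rw [norm_mul, Real.norm_eq_abs, Real.norm_eq_abs, abs_of_pos (gaussDensity_pos z)]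
      exact mul_le_mul_of_nonneg_right (hb _) (gaussDensity_pos z).le)
  rwa [integral_const_mul, integral_gaussDensity, mul_one] at this

theorem continuous_gaussAvg {h : ℝ → ℝ} (hc : Continuous h) {C : ℝ} (hb : ∀ x, |h x| ≤ C) :
    Continuous fun p : ℝ × ℝ => gaussAvg h p.1 p.2 := by
  unfold gaussAvg
  refine continuous_of_dominated (bound := fun z => C * gaussDensity z) (fun p => ?_)
    (fun p => ae_of_all _ fun z => ?_) (integrable_gaussDensity.const_mul C)
    (ae_of_all _ fun z => ?_)
  · exact (by fun_prop : Continuous _).aestronglyMeasurable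
  · rw [norm_mul, Real.norm_eq_abs, Real.norm_eq_abs, abs_of_pos (gaussDensity_pos z)]
    exact mul_le_mul_of_nonneg_right (hb _) (gaussDensity_pos z).le
  · fun_prop

theorem BoundedC2.hasDerivAt_gaussAvg {h h₁ h₂ : ℝ → ℝ} {C : ℝ} (H : BoundedC2 h h₁ h₂ C)
    (x t : ℝ) : HasDerivAt (fun x => gaussAvg h x t) (gaussAvg h₁ x t) x := by
  unfold gaussAvg
  have hc := H.continuous
  have hc' := H.continuous'
  refine (hasDerivAt_integral_of_dominated_loc_of_deriv_le (s := univ)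
    (bound := fun z => C * gaussDensity z) (F := fun x z => h (x + √t * z) * gaussDensity z)
    (F' := fun x z => h₁ (x + √t * z) * gaussDensity z) univ_mem
    (Eventually.of_forall fun x => (by fun_prop : Continuous _).aestronglyMeasurable)
    (integrable_comp_mul_gaussDensity hc H.bound x t)
    (by fun_prop : Continuous _).aestronglyMeasurable
    (ae_of_all _ fun z x _ => ?_) (integrable_gaussDensity.const_mul C)
    (ae_of_all _ fun z x _ => ?_)).2
  · rw [norm_mul, Real.norm_eq_abs, Real.norm_eq_abs, abs_of_pos (gaussDensity_pos z)]
    exact mul_le_mul_of_nonneg_right (H.bound' _) (gaussDensity_pos z).le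
  · have := (H.hasDerivAt (x + √t * z)).comp x ((hasDerivAt_id x).add_const (√t * z))
    simpa using this.mul_const (gaussDensity z)

theorem BoundedC2.integral_deriv_mul_gaussDensity {h h₁ h₂ : ℝ → ℝ} {C : ℝ}
    (H : BoundedC2 h h₁ h₂ C) (x t : ℝ) :
    ∫ z, h₁ (x + √t * z) * (z * gaussDensity z) = √t * gaussAvg h₂ x t := by
  have hc' := H.continuous'
  have hc'' := H.continuous_snd
  have key := integral_mul_deriv_eq_deriv_mul_of_integrable
    (u := fun z => h₁ (x + √t * z)) (u' := fun z => h₂ (x + √t * z) * √t)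
    (v := fun z => -gaussDensity z) (v' := fun z => z * gaussDensity z)
    (fun z _ => ?_) (fun z _ => ?_) ?_ ?_ ?_
  · rw [key, gaussAvg, ← integral_const_mul, ← integral_neg]
    congr 1
    funext z
    ring
  · have := (H.hasDerivAt' (x + √t * z)).comp z (((hasDerivAt_id z).const_mul √t).const_add x)
    exact this.congr_deriv (by simp)
  · exact (hasDerivAt_gaussDensity z).neg.congr_deriv (by simp)
  · exact integrable_mul_gaussDensity.bdd_mul (by fun_prop : Continuous _).aestronglyMeasurable
      (ae_of_all _ fun z => H.bound' (x + √t * z))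
  · refine ((integrable_comp_mul_gaussDensity hc'' H.bound_snd x t).const_mul (-√t)).congr
      (ae_of_all _ fun z => ?_)
    simp only [Pi.mul_apply]
    ring
  · refine ((integrable_comp_mul_gaussDensity hc' H.bound' x t).neg).congr
      (ae_of_all _ fun z => ?_)
    simp

theorem BoundedC2.hasDerivAt_gaussAvg_curve {h h₁ h₂ : ℝ → ℝ} {C : ℝ}
    (H : BoundedC2 h h₁ h₂ C) {c c' : ℝ → ℝ} {L t : ℝ} (ht : 0 < t)
    (hc : ∀ᶠ s in 𝓝 t, HasDerivAt c (c' s) s ∧ |c' s| ≤ L) :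
    HasDerivAt (fun s => gaussAvg h (c s) s)
      (c' t * gaussAvg h₁ (c t) t + 1 / 2 * gaussAvg h₂ (c t) t) t := by
  have hc0 := H.continuous
  have hc1 := H.continuous'
  have ht2 : 0 < √(t / 2) := Real.sqrt_pos.2 (by linarith)
  have hst : 0 < √t := Real.sqrt_pos.2 ht
  have key := (hasDerivAt_integral_of_dominated_loc_of_deriv_le (x₀ := t)
    (s := {s | (HasDerivAt c (c' s) s ∧ |c' s| ≤ L) ∧ t / 2 < s})
    (bound := fun z => C * (L * gaussDensity z + (2 * √(t / 2))⁻¹ * (|z| * gaussDensity z)))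
    (F := fun s z => h (c s + √s * z) * gaussDensity z)
    (F' := fun s z => h₁ (c s + √s * z) * (c' s + (2 * √s)⁻¹ * z) * gaussDensity z)
    (hc.and (eventually_gt_nhds (by linarith)))
    (Eventually.of_forall fun x => (by fun_prop : Continuous _).aestronglyMeasurable)
    (integrable_comp_mul_gaussDensity hc0 H.bound (c t) t)
    (by fun_prop : Continuous _).aestronglyMeasurable
    (ae_of_all _ fun z s hs => ?_)
    (((integrable_gaussDensity.const_mul L).add
      (integrable_abs_mul_gaussDensity.const_mul _)).const_mul C)
    (ae_of_all _ fun z s hs => ?_)).2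
  · refine key.congr_deriv ?_
    have i1 := integrable_comp_mul_gaussDensity hc1 H.bound' (c t) t
    have i2 : Integrable fun z => h₁ (c t + √t * z) * (z * gaussDensity z) :=
      integrable_mul_gaussDensity.bdd_mul (by fun_prop : Continuous _).aestronglyMeasurable
        (ae_of_all _ fun z => H.bound' (c t + √t * z))
    have e : (fun z => h₁ (c t + √t * z) * (c' t + (2 * √t)⁻¹ * z) * gaussDensity z) =
        fun z => c' t * (h₁ (c t + √t * z) * gaussDensity z) +
          (2 * √t)⁻¹ * (h₁ (c t + √t * z) * (z * gaussDensity z)) := by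
      funext z; ring
    rw [e, integral_add (i1.const_mul _) (i2.const_mul _), integral_const_mul,
      integral_const_mul, H.integral_deriv_mul_gaussDensity]
    unfold gaussAvg
    field_simp
  · obtain ⟨⟨-, hL⟩, hts⟩ := hs
    have hb : (2 * √s)⁻¹ ≤ (2 * √(t / 2))⁻¹ := by
      have := Real.sqrt_le_sqrt hts.le
      gcongr
    have hg := (gaussDensity_pos z).le
    rw [norm_mul, norm_mul, Real.norm_eq_abs, Real.norm_eq_abs, Real.norm_eq_abs,
      abs_of_nonneg hg, mul_assoc]
    have h3 : |c' s + (2 * √s)⁻¹ * z| ≤ L + (2 * √(t / 2))⁻¹ * |z| := by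
      refine (abs_add_le _ _).trans ?_
      rw [abs_mul, abs_of_nonneg (by positivity : 0 ≤ (2 * √s)⁻¹)]
      gcongr
    calc _ ≤ C * ((L + (2 * √(t / 2))⁻¹ * |z|) * gaussDensity z) := by
          have := H.nonneg
          have := H.bound' (c s + √s * z)
          gcongr
      _ = _ := by ring
  · obtain ⟨⟨hd, -⟩, hts⟩ := hs
    have hs0 : s ≠ 0 := by linarith
    have h1 := hd.add ((Real.hasDerivAt_sqrt hs0).mul_const z)
    have h2 := ((H.hasDerivAt (c s + √s * z)).comp s h1).mul_const (gaussDensity z)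
    refine h2.congr_deriv ?_
    simp

/-! ### Decay of the heat semigroup -/

theorem inv_one_add_sq_shift (a w : ℝ) :
    (1 + (a + w) ^ 2)⁻¹ ≤ 2 * (1 + w ^ 2) * (1 + a ^ 2)⁻¹ := by
  rw [← div_eq_mul_inv, le_div_iff₀ (by positivity), inv_mul_le_iff₀ (by positivity)]
  nlinarith [sq_nonneg (a + 2 * w), mul_nonneg (sq_nonneg (a + w)) (sq_nonneg w), sq_nonneg w]

theorem abs_gaussAvg_le_of_decay {h : ℝ → ℝ} {C T : ℝ}
    (hb : ∀ x, |h x| ≤ C * (1 + x ^ 2)⁻¹) (hT : 0 ≤ T) :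
    ∃ K, ∀ x t, t ≤ T → |gaussAvg h x t| ≤ K * (1 + x ^ 2)⁻¹ := by
  have hC : 0 ≤ C := by simpa using (abs_nonneg _).trans (hb 0)
  refine ⟨C * 2 * ((∫ z, gaussDensity z) + T * ∫ z, z ^ 2 * gaussDensity z), fun x t ht => ?_⟩
  have := norm_integral_le_of_norm_le ((integrable_gaussDensity.add
    (integrable_sq_mul_gaussDensity.const_mul T)).const_mul (C * 2 * (1 + x ^ 2)⁻¹))
    (f := fun z => h (x + √t * z) * gaussDensity z) (ae_of_all _ fun z => ?_)
  · rw [integral_const_mul, integral_add' integrable_gaussDensity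
      (integrable_sq_mul_gaussDensity.const_mul T), integral_const_mul] at this
    refine (this : |gaussAvg h x t| ≤ _).trans (le_of_eq ?_)
    ring
  · have hg := (gaussDensity_pos z).le
    rw [norm_mul, Real.norm_eq_abs, Real.norm_eq_abs, abs_of_nonneg hg]
    have h1 : (√t * z) ^ 2 ≤ T * z ^ 2 := by
      rw [mul_pow]
      have : √t ^ 2 ≤ T := by
        rcases le_or_gt 0 t with h0 | h0
        · rwa [Real.sq_sqrt h0]
        · rw [Real.sqrt_eq_zero_of_nonpos h0.le]; simpa using hT
      gcongr
    calc |h (x + √t * z)| * gaussDensity z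
        ≤ C * (2 * (1 + T * z ^ 2) * (1 + x ^ 2)⁻¹) * gaussDensity z := by
          gcongr
          refine (hb _).trans ?_
          gcongr
          refine (inv_one_add_sq_shift _ _).trans ?_
          gcongr
      _ = _ := by simp only [Pi.add_apply]; ring

theorem SchwartzMap.exists_decay (f : SchwartzMap ℝ ℝ) :
    ∃ C, ∀ x, |f x| ≤ C * (1 + x ^ 2)⁻¹ := by
  obtain ⟨C₀, -, h0⟩ := f.decay 0 0
  obtain ⟨C₂, -, h2⟩ := f.decay 2 0
  refine ⟨C₀ + C₂, fun x => ?_⟩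
  have h0 := h0 x
  have h2 := h2 x
  simp only [norm_iteratedFDeriv_zero, pow_zero, one_mul, Real.norm_eq_abs, sq_abs] at h0 h2
  rw [← div_eq_mul_inv, le_div_iff₀ (by positivity)]
  nlinarith

/-! ### Distribution functions and quantiles along the heat flow -/

theorem BoundedC2.tendsto_gaussAvg_atBot {h h₁ h₂ : ℝ → ℝ} {C : ℝ} (H : BoundedC2 h h₁ h₂ C)
    (hlim : Tendsto h atBot (𝓝 0)) (t : ℝ) :
    Tendsto (fun x => gaussAvg h x t) atBot (𝓝 0) := by
  have hc := H.continuous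
  have := tendsto_integral_filter_of_dominated_convergence (μ := volume) (l := atBot)
    (F := fun x z => h (x + √t * z) * gaussDensity z) (f := fun _ => 0)
    (fun z => C * gaussDensity z)
    (Eventually.of_forall fun x => (by fun_prop : Continuous _).aestronglyMeasurable)
    (Eventually.of_forall fun x => ae_of_all _ fun z => ?_)
    (integrable_gaussDensity.const_mul C) (ae_of_all _ fun z => ?_)
  · simpa [gaussAvg] using this
  · rw [norm_mul, Real.norm_eq_abs, Real.norm_eq_abs, abs_of_pos (gaussDensity_pos z)]
    exact mul_le_mul_of_nonneg_right (H.bound _) (gaussDensity_pos z).le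
  · simpa using (hlim.comp (tendsto_atBot_add_const_right _ (√t * z) tendsto_id)).mul_const
      (gaussDensity z)

theorem integrable_of_continuous_of_decay {g : ℝ → ℝ} (hg : Continuous g) {K : ℝ}
    (hb : ∀ x, |g x| ≤ K * (1 + x ^ 2)⁻¹) : Integrable g :=
  (integrable_inv_one_add_sq.const_mul K).mono' hg.aestronglyMeasurable (ae_of_all _ hb)

theorem setIntegral_Iic_gaussAvg {h h₁ h₂ : ℝ → ℝ} {C K : ℝ} (H : BoundedC2 h h₁ h₂ C)
    (hlim : Tendsto h atBot (𝓝 0)) (hdecay : ∀ x, |h₁ x| ≤ K * (1 + x ^ 2)⁻¹) {t : ℝ}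
    (ht : 0 ≤ t) (r : ℝ) : ∫ x in Iic r, gaussAvg h₁ x t = gaussAvg h r t := by
  obtain ⟨K', hK'⟩ := abs_gaussAvg_le_of_decay hdecay ht
  have hcont : Continuous fun x => gaussAvg h₁ x t :=
    (continuous_gaussAvg H.continuous' H.bound').comp (by fun_prop : Continuous fun x => (x, t))
  rw [integral_Iic_of_hasDerivAt_of_tendsto' (fun x _ => H.hasDerivAt_gaussAvg x t)
    (integrable_of_continuous_of_decay hcont fun x => hK' x t le_rfl).integrableOn
    (H.tendsto_gaussAvg_atBot hlim t), sub_zero]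

theorem gaussAvg_pos {f : ℝ → ℝ} {C : ℝ} (hc : Continuous f) (hb : ∀ x, |f x| ≤ C)
    (h0 : ∀ x, 0 ≤ f x) {x₀ : ℝ} (hx₀ : 0 < f x₀) (x : ℝ) {t : ℝ} (ht : 0 < t) :
    0 < gaussAvg f x t := by
  have hs : 0 < √t := Real.sqrt_pos.2 ht
  refine integral_pos_of_integrable_nonneg_nonzero (x := (x₀ - x) / √t) (by fun_prop)
    (integrable_comp_mul_gaussDensity hc hb x t)
    (fun z => mul_nonneg (h0 _) (gaussDensity_pos z).le) ?_
  rw [mul_div_cancel₀ _ hs.ne', add_sub_cancel]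
  exact (mul_pos hx₀ (gaussDensity_pos _)).ne'

theorem continuousOn_quantile {F : ℝ → ℝ → ℝ} {q : ℝ → ℝ} {α : ℝ} {S : Set ℝ}
    (hF : Continuous fun p : ℝ × ℝ => F p.1 p.2) (hmono : ∀ t ∈ S, Monotone fun r => F r t)
    (hq : ∀ t ∈ S, F (q t) t = α) (huniq : ∀ t ∈ S, ∀ r, F r t = α → r = q t) :
    ContinuousOn q S := by
  have hcont : ∀ a, Continuous fun t => F a t := fun a =>
    hF.comp (by fun_prop : Continuous fun t => (a, t))
  intro t ht
  refine tendsto_order.2 ⟨fun a ha => ?_, fun a ha => ?_⟩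
  · have h1 : F a t < α :=
      lt_of_le_of_ne (hq t ht ▸ hmono t ht ha.le) fun h => ha.ne (huniq t ht a h)
    filter_upwards [mem_nhdsWithin_of_mem_nhds ((hcont a).continuousAt.eventually_lt_const h1),
      self_mem_nhdsWithin] with s hs hsS
    by_contra! hle
    exact absurd (hq s hsS ▸ hmono s hsS hle) (not_le.2 hs)
  · have h1 : α < F a t :=
      lt_of_le_of_ne (hq t ht ▸ hmono t ht ha.le) fun h => ha.ne' (huniq t ht a h.symm)
    filter_upwards [mem_nhdsWithin_of_mem_nhds ((hcont a).continuousAt.eventually_const_lt h1),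
      self_mem_nhdsWithin] with s hs hsS
    by_contra! hle
    exact absurd (hq s hsS ▸ hmono s hsS hle) (not_le.2 hs)

private theorem exists_mean_value {g g' : ℝ → ℝ} (hg : ∀ x, HasDerivAt g (g' x) x) (a b : ℝ) :
    ∃ ξ, |ξ - a| ≤ |b - a| ∧ g b - g a = g' ξ * (b - a) := by
  have hc : Continuous g := continuous_iff_continuousAt.2 fun x => (hg x).continuousAt
  rcases lt_trichotomy a b with h | rfl | h
  · obtain ⟨ξ, hξ, e⟩ := exists_hasDerivAt_eq_slope g g' h hc.continuousOn fun x _ => hg x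
    refine ⟨ξ, ?_, ?_⟩
    · rw [abs_of_pos (sub_pos.2 hξ.1), abs_of_pos (sub_pos.2 h)]
      linarith [hξ.2]
    · rw [e, div_mul_cancel₀ _ (sub_pos.2 h).ne']
  · exact ⟨a, le_rfl, by simp⟩
  · obtain ⟨ξ, hξ, e⟩ := exists_hasDerivAt_eq_slope g g' h hc.continuousOn fun x _ => hg x
    refine ⟨ξ, ?_, ?_⟩
    · rw [abs_of_neg (sub_neg.2 hξ.2), abs_of_neg (sub_neg.2 h)]
      linarith [hξ.1]
    · rw [eq_div_iff (sub_pos.2 h).ne'] at e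
      linarith

theorem hasDerivAt_quantile {F u : ℝ → ℝ → ℝ} {q : ℝ → ℝ} {α t d : ℝ}
    (hF : ∀ r s, HasDerivAt (fun r => F r s) (u r s) r)
    (hu : Continuous fun p : ℝ × ℝ => u p.1 p.2) (hut : u (q t) t ≠ 0)
    (hFt : HasDerivAt (fun s => F (q t) s) d t) (hqc : ContinuousAt q t)
    (hq : ∀ᶠ s in 𝓝 t, F (q s) s = α) :
    HasDerivAt q (-d / u (q t) t) t := by
  choose ξ hξ hξe using fun s => exists_mean_value (fun r => hF r s) (q t) (q s)
  have hξt : Tendsto ξ (𝓝 t) (𝓝 (q t)) := by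
    rw [tendsto_iff_dist_tendsto_zero]
    exact squeeze_zero (fun _ => dist_nonneg) hξ (tendsto_iff_dist_tendsto_zero.1 hqc)
  have hul : Tendsto (fun s => u (ξ s) s) (𝓝 t) (𝓝 (u (q t) t)) :=
    (hu.tendsto (q t, t)).comp (hξt.prodMk_nhds tendsto_id)
  rw [hasDerivAt_iff_tendsto_slope] at hFt ⊢
  refine (hFt.neg.div (hul.mono_left nhdsWithin_le_nhds) hut).congr' ?_
  filter_upwards [nhdsWithin_le_nhds hq, nhdsWithin_le_nhds (hul.eventually_ne hut)] with s h1 h2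
  have h3 := hξe s
  rw [h1, ← hq.self_of_nhds] at h3
  rw [Pi.div_apply, div_eq_iff h2, slope_def_field, slope_def_field, div_mul_eq_mul_div, ← neg_div]
  congr 1
  linarith

/-! ### Derivatives of the joint distribution function -/

theorem tendsto_atBot_zero_of_decay {g : ℝ → ℝ} {K : ℝ}
    (hb : ∀ x, |g x| ≤ K * (1 + x ^ 2)⁻¹) : Tendsto g atBot (𝓝 0) := by
  refine squeeze_zero_norm hb ?_
  have h : Tendsto (fun x : ℝ => 1 + x ^ 2) atBot atTop :=
    tendsto_atTop_add_const_left _ _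
      ((tendsto_pow_atTop two_ne_zero).comp tendsto_abs_atBot_atTop |>.congr fun x => sq_abs x)
  simpa using h.inv_tendsto_atTop.const_mul K

theorem setIntegral_Iic_eq_comp_add (g : ℝ → ℝ) (c : ℝ) :
    ∫ x in Iic c, g x = ∫ y in Iic 0, g (c + y) := by
  have := (measurePreserving_add_left (volume : Measure ℝ) c).setIntegral_preimage_emb
    (measurableEmbedding_addLeft c) g (Iic c)
  rw [← this]
  simp

theorem abs_gaussKernel_mul_le {τ τ₀ d β γ L : ℝ} (hτ₀ : 0 < τ₀) (hτ : τ₀ / 2 < τ)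
    (hβ : |β| ≤ L) (hγ : |γ| ≤ 1) :
    |gaussKernel τ d * (β - d * γ / (2 * τ))| ≤ L * (√(τ₀ / 2))⁻¹ + τ₀⁻¹ := by
  have hτ0 : 0 < τ := by linarith
  have hs : 0 < √(τ₀ / 2) := Real.sqrt_pos.2 (by linarith)
  have h1 : gaussKernel τ d ≤ (√(τ₀ / 2))⁻¹ := by
    refine (gaussKernel_le τ d).trans ?_
    have := Real.sqrt_le_sqrt hτ.le
    gcongr
  have h2 : gaussKernel τ d * |d / τ| ≤ 2 * τ₀⁻¹ := by
    refine (gaussKernel_mul_abs_le hτ0 d).trans ?_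
    rw [show 2 * τ₀⁻¹ = (τ₀ / 2)⁻¹ by rw [inv_div]; ring]
    gcongr
  have h0 := gaussKernel_nonneg τ d
  have h3 : |β - d * γ / (2 * τ)| ≤ L + |d / τ| / 2 := by
    refine (abs_sub _ _).trans ?_
    have : d * γ / (2 * τ) = d / τ / 2 * γ := by ring
    rw [this, abs_mul, abs_div (d / τ) 2, abs_two]
    have : |d / τ| / 2 * |γ| ≤ |d / τ| / 2 * 1 := by gcongr
    linarith
  have hL : 0 ≤ L := (abs_nonneg _).trans hβ
  rw [abs_mul, abs_of_nonneg h0]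
  calc _ ≤ gaussKernel τ d * (L + |d / τ| / 2) := by gcongr
    _ = L * gaussKernel τ d + gaussKernel τ d * |d / τ| / 2 := by ring
    _ ≤ L * (√(τ₀ / 2))⁻¹ + 2 * τ₀⁻¹ / 2 := by gcongr
    _ = _ := by ring

theorem hasDerivAt_setIntegral_gaussCdf_right {w w₁ b b' : ℝ → ℝ} {C L s t : ℝ}
    (hw : ∀ x, HasDerivAt w (w₁ x) x) (hw₁ : Continuous w₁)
    (hd : ∀ x, |w x| ≤ C * (1 + x ^ 2)⁻¹) (hd₁ : ∀ x, |w₁ x| ≤ C * (1 + x ^ 2)⁻¹)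
    (hst : s < t) (hb : ∀ᶠ r in 𝓝 t, HasDerivAt b (b' r) r ∧ |b' r| ≤ L) (a : ℝ) :
    HasDerivAt (fun r => ∫ x in Iic a, gaussCdf ((b r - x) / √(r - s)) * w x)
      (-(1 / 2) * gaussKernel (t - s) (b t - a) * w a +
        ∫ x in Iic a, gaussKernel (t - s) (b t - x) * (1 / 2 * w₁ x + b' t * w x)) t := by
  have hwc : Continuous w := continuous_iff_continuousAt.2 fun x => (hw x).continuousAt
  have hτ : 0 < t - s := sub_pos.2 hst
  have hk : Continuous (gaussKernel (t - s)) := continuous_gaussKernel _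
  have hwi := integrable_of_continuous_of_decay hwc hd
  have hw1i := integrable_of_continuous_of_decay hw₁ hd₁
  have hdb : ∀ x, HasDerivAt (fun x => b t - x) (-1) x := fun x => by
    simpa using (hasDerivAt_id x).const_sub (b t)
  have hkb : ∀ x, ‖gaussKernel (t - s) (b t - x)‖ ≤ (√(t - s))⁻¹ := fun x => by
    rw [Real.norm_eq_abs, abs_of_nonneg (gaussKernel_nonneg _ _)]
    exact gaussKernel_le _ _
  set D := L * (√((t - s) / 2))⁻¹ + (t - s)⁻¹ with hD
  have key := hasDerivAt_integral_of_dominated_loc_of_deriv_le (x₀ := t)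
    (μ := volume.restrict (Iic a))
    (s := {r | (HasDerivAt b (b' r) r ∧ |b' r| ≤ L) ∧ s + (t - s) / 2 < r})
    (bound := fun x => D * |w x|)
    (F := fun r x => gaussCdf ((b r - x) / √(r - s)) * w x)
    (F' := fun r x => gaussKernel (r - s) (b r - x) *
      (b' r - (b r - x) * 1 / (2 * (r - s))) * w x)
    (hb.and (eventually_gt_nhds (by linarith)))
    (Eventually.of_forall fun r => (by fun_prop : Continuous _).aestronglyMeasurable)
    ((hwi.bdd_mul (by fun_prop : Continuous _).aestronglyMeasurable
      (ae_of_all _ fun x => abs_gaussCdf_le_one ((b t - x) / √(t - s)))).integrableOn)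
    (by fun_prop : Continuous _).aestronglyMeasurable
    (ae_of_all _ fun x r hr => ?_) (hwi.abs.const_mul D).integrableOn
    (ae_of_all _ fun x r hr => ?_)
  · refine key.2.congr_deriv ?_
    have hi : IntegrableOn (fun x => gaussKernel (t - s) (b t - x) *
        (1 / 2 * w₁ x + b' t * w x)) (Iic a) :=
      (((hw1i.const_mul (1 / 2)).add (hwi.const_mul (b' t))).bdd_mul
        (by fun_prop : Continuous _).aestronglyMeasurable (ae_of_all _ hkb)).integrableOn
    have hQ := integral_Iic_of_hasDerivAt_of_tendsto' (a := a) (m := 0)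
      (f := fun x => -(1 / 2) * gaussKernel (t - s) (b t - x) * w x)
      (f' := fun x => gaussKernel (t - s) (b t - x) *
          (b' t - (b t - x) * 1 / (2 * (t - s))) * w x -
        gaussKernel (t - s) (b t - x) * (1 / 2 * w₁ x + b' t * w x))
      (fun x _ => ?_) (key.1.sub hi) ?_
    · rw [integral_sub key.1 hi] at hQ
      linarith
    · have h1 := HasDerivAt.gaussKernel (hdb x) (hasDerivAt_const x (t - s)) hτ
      refine ((h1.const_mul (-(1 / 2))).mul (hw x)).congr_deriv ?_
      field_simp
      ring
    · refine tendsto_atBot_zero_of_decay (K := 1 / 2 * (√(t - s))⁻¹ * C) fun x => ?_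
      have h1 := hkb x
      rw [Real.norm_eq_abs] at h1
      rw [abs_mul, abs_mul, abs_neg, abs_of_pos (by norm_num : (0 : ℝ) < 1 / 2)]
      have := hd x
      calc _ ≤ 1 / 2 * (√(t - s))⁻¹ * (C * (1 + x ^ 2)⁻¹) := by gcongr
        _ = _ := by ring
  · obtain ⟨⟨-, hL⟩, hr⟩ := hr
    rw [norm_mul, Real.norm_eq_abs, Real.norm_eq_abs]
    have := abs_gaussKernel_mul_le (τ := r - s) (d := b r - x) hτ (by linarith) hL
      (abs_one (α := ℝ)).le
    gcongr
  · obtain ⟨⟨hbr, -⟩, hr⟩ := hr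
    exact ((hbr.sub_const x).gaussCdf_div_sqrt ((hasDerivAt_id r).sub_const s)
      (by simp only [id]; linarith)).mul_const (w x)

theorem hasDerivAt_setIntegral_gaussCdf_left {f f₁ f₂ f₃ c c' : ℝ → ℝ} {C K L s t : ℝ}
    (H : BoundedC2 f f₁ f₂ C) (H' : BoundedC2 f₁ f₂ f₃ C)
    (hd : ∀ x r, r ≤ t → |gaussAvg f x r| ≤ K * (1 + x ^ 2)⁻¹)
    (hd₁ : ∀ x r, r ≤ t → |gaussAvg f₁ x r| ≤ K * (1 + x ^ 2)⁻¹)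
    (hd₂ : ∀ x r, r ≤ t → |gaussAvg f₂ x r| ≤ K * (1 + x ^ 2)⁻¹)
    (hs : 0 < s) (hst : s < t) (hc : ∀ᶠ r in 𝓝 s, HasDerivAt c (c' r) r ∧ |c' r| ≤ L) (b : ℝ) :
    HasDerivAt (fun r => ∫ x in Iic (c r), gaussCdf ((b - x) / √(t - r)) * gaussAvg f x r)
      (gaussCdf ((b - c s) / √(t - s)) *
          (c' s * gaussAvg f (c s) s + 1 / 2 * gaussAvg f₁ (c s) s) +
        1 / 2 * gaussKernel (t - s) (b - c s) * gaussAvg f (c s) s) s := by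
  have hτ : 0 < t - s := sub_pos.2 hst
  have hk : Continuous (gaussKernel (t - s)) := continuous_gaussKernel _
  have hu : ∀ r x, Continuous fun y => gaussAvg f (x + y) r := fun r x =>
    (continuous_gaussAvg H.continuous H.bound).comp (by fun_prop : Continuous fun y => (x + y, r))
  have hu1 : ∀ r x, Continuous fun y => gaussAvg f₁ (x + y) r := fun r x =>
    (continuous_gaussAvg H.continuous' H.bound').comp (by fun_prop : Continuous fun y => (x + y, r))
  have hu2 : ∀ r x, Continuous fun y => gaussAvg f₂ (x + y) r := fun r x =>
    (continuous_gaussAvg H.continuous_snd H.bound_snd).comp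
      (by fun_prop : Continuous fun y => (x + y, r))
  have hK : 0 ≤ K := by simpa using (abs_nonneg _).trans (hd 0 t le_rfl)
  simp_rw [setIntegral_Iic_eq_comp_add _ (c _)]
  have hcc : ContinuousAt c s := hc.self_of_nhds.1.continuousAt
  set R := |c s| + 1 with hR
  have hcR : ∀ᶠ r in 𝓝 s, |c r| ≤ R :=
    (hcc.abs.eventually_lt_const (by linarith : |c s| < R)).mono fun _ => le_of_lt
  set D := L * (√((t - s) / 2))⁻¹ + (t - s)⁻¹ with hD
  have hL0 : 0 ≤ L := (abs_nonneg _).trans hc.self_of_nhds.2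
  have hD0 : 0 ≤ D := by positivity
  have hshift : ∀ g : ℝ → ℝ → ℝ, (∀ x r, r ≤ t → |g x r| ≤ K * (1 + x ^ 2)⁻¹) →
      ∀ r y, |c r| ≤ R → r ≤ t → |g (c r + y) r| ≤ K * (2 * (1 + R ^ 2)) * (1 + y ^ 2)⁻¹ := by
    intro g hg r y hr hrt
    refine (hg _ _ hrt).trans ?_
    have h1 := inv_one_add_sq_shift y (c r)
    have h2 : c r ^ 2 ≤ R ^ 2 := by rw [← sq_abs]; gcongr
    rw [add_comm y] at h1
    calc _ ≤ K * (2 * (1 + c r ^ 2) * (1 + y ^ 2)⁻¹) := by gcongr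
      _ ≤ K * (2 * (1 + R ^ 2) * (1 + y ^ 2)⁻¹) := by gcongr
      _ = _ := by ring
  have hui : Integrable fun y => gaussAvg f (c s + y) s :=
    integrable_of_continuous_of_decay (hu s (c s)) fun y =>
      hshift _ hd s y hcR.self_of_nhds hst.le
  have key := hasDerivAt_integral_of_dominated_loc_of_deriv_le (x₀ := s)
    (μ := volume.restrict (Iic 0))
    (s := {r | (∀ᶠ r' in 𝓝 r, HasDerivAt c (c' r') r' ∧ |c' r'| ≤ L) ∧ |c r| ≤ R ∧
      0 < r ∧ r < s + (t - s) / 2})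
    (bound := fun y => (D + (L + 1 / 2)) * (K * (2 * (1 + R ^ 2)) * (1 + y ^ 2)⁻¹))
    (F := fun r y => gaussCdf ((b - (c r + y)) / √(t - r)) * gaussAvg f (c r + y) r)
    (F' := fun r y => gaussKernel (t - r) (b - (c r + y)) *
        (-c' r - (b - (c r + y)) * (-1) / (2 * (t - r))) * gaussAvg f (c r + y) r +
      gaussCdf ((b - (c r + y)) / √(t - r)) *
        (c' r * gaussAvg f₁ (c r + y) r + 1 / 2 * gaussAvg f₂ (c r + y) r))
    (hc.eventually_nhds.and (hcR.and ((eventually_gt_nhds hs).and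
      (eventually_lt_nhds (by linarith)))))
    (Eventually.of_forall fun r => (by fun_prop : Continuous _).aestronglyMeasurable)
    ((hui.bdd_mul (by fun_prop : Continuous _).aestronglyMeasurable
      (ae_of_all _ fun y => abs_gaussCdf_le_one ((b - (c s + y)) / √(t - s)))).integrableOn)
    (by fun_prop : Continuous _).aestronglyMeasurable
    (ae_of_all _ fun y r hr => ?_)
    ((integrable_inv_one_add_sq.const_mul _).const_mul _).integrableOn
    (ae_of_all _ fun y r hr => ?_)
  · refine key.2.congr_deriv ?_
    have hin : ∀ y, HasDerivAt (fun y => c s + y) 1 y := fun y => by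
      simpa using (hasDerivAt_id y).const_add (c s)
    have hdd : ∀ y, HasDerivAt (fun y => b - (c s + y)) (-1) y := fun y => (hin y).const_sub b
    have hP := integral_Iic_of_hasDerivAt_of_tendsto' (a := 0) (m := 0)
      (f := fun y => gaussCdf ((b - (c s + y)) / √(t - s)) *
          (c' s * gaussAvg f (c s + y) s + 1 / 2 * gaussAvg f₁ (c s + y) s) +
        1 / 2 * gaussKernel (t - s) (b - (c s + y)) * gaussAvg f (c s + y) s)
      (fun y _ => ?_) key.1 ?_
    · simpa using hP
    · have g0 := (H.hasDerivAt_gaussAvg (c s + y) s).comp y (hin y)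
      have g1 := (H'.hasDerivAt_gaussAvg (c s + y) s).comp y (hin y)
      have h1 := HasDerivAt.gaussCdf_div_sqrt (hdd y) (hasDerivAt_const y (t - s)) hτ
      have h2 := HasDerivAt.gaussKernel (hdd y) (hasDerivAt_const y (t - s)) hτ
      refine ((h1.mul ((g0.const_mul (c' s)).add (g1.const_mul (1 / 2)))).add
        ((h2.const_mul (1 / 2)).mul g0)).congr_deriv ?_
      simp only [Function.comp_apply, Pi.add_apply]
      field_simp
      ring
    · refine tendsto_atBot_zero_of_decay (K := (L + 1 / 2 + 1 / 2 * (√(t - s))⁻¹) *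
        (K * (2 * (1 + R ^ 2)))) fun y => ?_
      have e0 := hshift _ hd s y hcR.self_of_nhds hst.le
      have e1 := hshift _ hd₁ s y hcR.self_of_nhds hst.le
      have hL := hc.self_of_nhds.2
      refine (abs_add_le _ _).trans ?_
      rw [abs_mul, abs_mul, abs_mul, abs_of_nonneg (gaussKernel_nonneg _ _),
        abs_of_pos (by norm_num : (0 : ℝ) < 1 / 2)]
      have e2 : |c' s * gaussAvg f (c s + y) s + 1 / 2 * gaussAvg f₁ (c s + y) s| ≤
          (L + 1 / 2) * (K * (2 * (1 + R ^ 2)) * (1 + y ^ 2)⁻¹) := by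
        refine (abs_add_le _ _).trans ?_
        rw [abs_mul, abs_mul, abs_of_pos (by norm_num : (0 : ℝ) < 1 / 2), add_mul]
        gcongr
      have e3 := abs_gaussCdf_le_one ((b - (c s + y)) / √(t - s))
      have e4 := gaussKernel_le (t - s) (b - (c s + y))
      calc _ ≤ 1 * ((L + 1 / 2) * (K * (2 * (1 + R ^ 2)) * (1 + y ^ 2)⁻¹)) +
            1 / 2 * (√(t - s))⁻¹ * (K * (2 * (1 + R ^ 2)) * (1 + y ^ 2)⁻¹) := by gcongr
        _ = _ := by ring
  · obtain ⟨hcr, hRr, hr0, hr⟩ := hr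
    have hrt : r ≤ t := by linarith
    have e0 := hshift _ hd r y hRr hrt
    have e1 := hshift _ hd₁ r y hRr hrt
    have e2 := hshift _ hd₂ r y hRr hrt
    have hL := hcr.self_of_nhds.2
    have e3 := abs_gaussCdf_le_one ((b - (c r + y)) / √(t - r))
    have e4 := abs_gaussKernel_mul_le (τ := t - r) (d := b - (c r + y)) (β := -c' r) (γ := -1)
      (L := L) hτ (by linarith) (by rwa [abs_neg]) (by simp)
    have e5 : |c' r * gaussAvg f₁ (c r + y) r + 1 / 2 * gaussAvg f₂ (c r + y) r| ≤
        (L + 1 / 2) * (K * (2 * (1 + R ^ 2)) * (1 + y ^ 2)⁻¹) := by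
      refine (abs_add_le _ _).trans ?_
      rw [abs_mul, abs_mul, abs_of_pos (by norm_num : (0 : ℝ) < 1 / 2), add_mul]
      gcongr
    refine (norm_add_le _ _).trans ?_
    simp only [norm_mul _ (gaussAvg f (c r + y) r), norm_mul (gaussCdf _), Real.norm_eq_abs]
    calc _ ≤ D * (K * (2 * (1 + R ^ 2)) * (1 + y ^ 2)⁻¹) +
          1 * ((L + 1 / 2) * (K * (2 * (1 + R ^ 2)) * (1 + y ^ 2)⁻¹)) := by gcongr
      _ = _ := by ring
  · obtain ⟨hcr, hRr, hr0, hr⟩ := hr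
    have h0 := hcr.self_of_nhds.1.add_const y
    have h1 := HasDerivAt.gaussCdf_div_sqrt (h0.const_sub b)
      ((hasDerivAt_id r).const_sub t) (by simp only [id]; linarith)
    have h2 := H.hasDerivAt_gaussAvg_curve (c := fun r => c r + y) (c' := c') (L := L) hr0
      (hcr.mono fun r' h => ⟨h.1.add_const y, h.2⟩)
    exact h1.mul h2

/-! ### From derivative formulas to bounds near the diagonal -/

theorem gaussDensity_mul_le_gaussKernel {τ d L : ℝ} (hτ : 0 < τ) (hτ1 : τ ≤ 1)
    (hd : |d| ≤ L * τ) : gaussDensity L * (√τ)⁻¹ ≤ gaussKernel τ d := by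
  have hs : 0 < √τ := Real.sqrt_pos.2 hτ
  have h1 : (d / √τ) ^ 2 ≤ L ^ 2 := by
    rw [div_pow, Real.sq_sqrt hτ.le, div_le_iff₀ hτ, ← sq_abs d]
    calc |d| ^ 2 ≤ (L * τ) ^ 2 := by gcongr
      _ = L ^ 2 * τ * τ := by ring
      _ ≤ L ^ 2 * τ * 1 := by gcongr
      _ = _ := by ring
  unfold gaussKernel
  rw [mul_comm]
  unfold gaussDensity
  gcongr

private theorem bounds_aux {k x c w m M K E : ℝ} {p : ℝ} (hm : 0 < m) (hc : 0 < c)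
    (hx : 1 ≤ x) (hK : 8 * M * K / c ≤ x) (hp : 0 < p) (hw : m ≤ w) (hwM : w ≤ M)
    (hkl : c * x ≤ k) (hku : k ≤ x) (hK0 : 0 ≤ K) (hE : |E| ≤ K * p) {y : ℝ}
    (hy : y = p * x) :
    c / (8 * M) * y ≤ k * p * w⁻¹ / 4 - E ∧ k * p * w⁻¹ / 2 - E ≤ (1 / m + K) * y := by
  have hw0 : 0 < w := hm.trans_le hw
  have hM : 0 < M := hw0.trans_le hwM
  obtain ⟨hE1, hE2⟩ := abs_le.1 hE
  have hx0 : 0 < x := by linarith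
  have hk : 0 < k := (mul_pos hc hx0).trans_le hkl
  have h1 : K ≤ c / (8 * M) * x := by
    rw [div_le_iff₀ hc] at hK
    rw [div_mul_eq_mul_div, le_div_iff₀ (by positivity)]
    linarith
  have h2 : c * x * p * M⁻¹ ≤ k * p * w⁻¹ := by gcongr
  have h3 : k * p * w⁻¹ ≤ x * p * m⁻¹ := by gcongr
  have h4 : K * p ≤ c / (8 * M) * x * p := by gcongr
  have h5 : K * p ≤ K * p * x := le_mul_of_one_le_right (by positivity) hx
  have h6 : c / (8 * M) * x * p = c * x * p * M⁻¹ / 8 := by field_simp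
  have h7 : 0 ≤ x * p * m⁻¹ := by positivity
  subst hy
  constructor
  · have : c / (8 * M) * (p * x) = c * x * p * M⁻¹ / 8 := by field_simp
    linarith
  · have : (1 / m + K) * (p * x) = x * p * m⁻¹ + K * p * x := by field_simp
    linarith

section NearDiagonal

variable {q q' v v' : ℝ → ℝ} {A Rm : ℝ → ℝ → ℝ} {T m M L V : ℝ}

private theorem hasDerivAt_left_quotient {s t : ℝ} (hvs : v s ≠ 0) (hvt : v t ≠ 0)
    (hv : HasDerivAt v (v' s) s)
    (hA : HasDerivAt (fun r => A r t) (1 / 2 * gaussKernel (t - s) (q t - q s) * v s) s) :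
    HasDerivAt (fun r => A r t / (v r * v t))
      (1 / 2 * gaussKernel (t - s) (q t - q s) * (v t)⁻¹ -
        A s t * (v' s * (v s)⁻¹ ^ 2) * (v t)⁻¹) s := by
  refine (hA.div (hv.mul_const (v t)) (mul_ne_zero hvs hvt)).congr_deriv ?_
  field_simp

private theorem hasDerivAt_right_quotient {s t a : ℝ} (hvs : v s ≠ 0) (hvt : v t ≠ 0)
    (hv : HasDerivAt v (v' t) t) (hA : HasDerivAt (fun r => A s r) a t) :
    HasDerivAt (fun r => A s r / (v s * v r))
      (a * (v s)⁻¹ * (v t)⁻¹ - A s t * (v s)⁻¹ * (v' t * (v t)⁻¹ ^ 2)) t := by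
  refine (hA.div (hv.const_mul (v s)) (mul_ne_zero hvs hvt)).congr_deriv ?_
  field_simp

private theorem abs_sub_le_of_hasDerivAt {s t : ℝ} (hst : s ≤ t)
    (hq : ∀ r ∈ Icc s t, HasDerivAt q (q' r) r) (hL : ∀ r ∈ Icc s t, |q' r| ≤ L) :
    |q t - q s| ≤ L * (t - s) := by
  have := (convex_Icc s t).norm_image_sub_le_of_norm_hasDerivWithin_le
    (fun r hr => (hq r hr).hasDerivWithinAt) hL (left_mem_Icc.2 hst) (right_mem_Icc.2 hst)
  rwa [Real.norm_eq_abs, Real.norm_eq_abs, abs_of_nonneg (sub_nonneg.2 hst)] at this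

private theorem abs_mixed_remainder_le {Δ τ p k x n a b vs ws wt A R : ℝ} (hτ : 0 < τ)
    (hΔ : |Δ| ≤ L * τ) (hp : |p| ≤ L) (hk0 : 0 ≤ k) (hku : k ≤ x) (hx1 : 1 ≤ x) (hvs : 0 < vs)
    (hvsM : vs ≤ M) (ha0 : 0 < a) (ha : a ≤ n) (hb0 : 0 < b) (hb : b ≤ n) (hws : |ws| ≤ V)
    (hwt : |wt| ≤ V) (hA : |A| ≤ 1) (hR : |R| ≤ V) :
    |1 / 2 * k * (Δ ^ 2 / (2 * τ ^ 2) - Δ * p / τ) * b - 1 / 2 * k * (wt * b ^ 2) -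
      (-(1 / 2) * k * vs + R) * (ws * a ^ 2) * b + A * (ws * a ^ 2) * (wt * b ^ 2)| ≤
    (3 / 4 * L ^ 2 * n + 1 / 2 * (V * n ^ 2) + (1 / 2 * M + V) * V * n ^ 3 + V ^ 2 * n ^ 4) *
      x ^ 2 := by
  have hL0 : 0 ≤ L := (abs_nonneg _).trans hp
  have hV0 : 0 ≤ V := (abs_nonneg _).trans hR
  have hM0 : 0 < M := hvs.trans_le hvsM
  have hn0 : 0 < n := ha0.trans_le ha
  have hquot : |Δ ^ 2 / (2 * τ ^ 2) - Δ * p / τ| ≤ 3 / 2 * L ^ 2 := by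
    refine (abs_sub _ _).trans ?_
    rw [abs_div, abs_div, abs_of_pos (show 0 < 2 * τ ^ 2 by positivity), abs_pow, abs_mul,
      abs_of_pos hτ]
    calc _ ≤ (L * τ) ^ 2 / (2 * τ ^ 2) + L * τ * L / τ := by
          gcongr
      _ = 3 / 2 * L ^ 2 := by
          field_simp
          ring
  have hx12 : x ≤ x ^ 2 := le_self_pow₀ hx1 two_ne_zero
  have hx22 : 1 ≤ x ^ 2 := hx1.trans hx12
  have h3 : |-(1 / 2) * k * vs + R| ≤ (1 / 2 * M + V) * x := by
    refine (abs_add_le _ _).trans ?_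
    rw [abs_mul, abs_mul, abs_neg, abs_of_pos (one_half_pos (α := ℝ)), abs_of_nonneg hk0,
      abs_of_pos hvs]
    calc _ ≤ 1 / 2 * x * M + V * x :=
          add_le_add (by gcongr) (hR.trans (le_mul_of_one_le_right hV0 hx1))
      _ = _ := by ring
  refine (abs_add_le _ _).trans ((add_le_add ((abs_sub _ _).trans
    (add_le_add ((abs_sub _ _).trans (add_le_add (b := 1 / 2 * x * (3 / 2 * L ^ 2) * n)
      (d := 1 / 2 * x * (V * n ^ 2)) ?_ ?_)) (?_ : _ ≤ (1 / 2 * M + V) * x * (V * n ^ 2) * n)))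
        (?_ : _ ≤ 1 * (V * n ^ 2) * (V * n ^ 2))).trans ?_)
  · simp only [abs_mul, abs_of_pos hb0, abs_of_nonneg hk0, abs_of_pos (one_half_pos (α := ℝ))]
    gcongr
  · simp only [abs_mul, abs_of_pos (pow_pos hb0 2), abs_of_nonneg hk0,
      abs_of_pos (one_half_pos (α := ℝ))]
    gcongr
  · rw [abs_mul, abs_mul, abs_mul, abs_of_pos hb0, abs_of_pos (pow_pos ha0 2)]
    gcongr
  · simp only [abs_mul, abs_of_pos (pow_pos hb0 2), abs_of_pos (pow_pos ha0 2)]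
    gcongr
  · calc _ ≤ 1 / 2 * x ^ 2 * (3 / 2 * L ^ 2) * n + 1 / 2 * x ^ 2 * (V * n ^ 2) +
          (1 / 2 * M + V) * x ^ 2 * (V * n ^ 2) * n + x ^ 2 * (V * n ^ 2) * (V * n ^ 2) := by
          gcongr
      _ = _ := by ring

/-- If `A` has the derivatives of the centred joint distribution function and `v` is bounded away
from zero with bounded derivative, then the quotient `A s t / (v s * v t)` satisfies the derivative
bounds near the diagonal. -/
theorem quotient_partial_derivative_bounds {T' : ℝ} (hT : T < T') (hm : 0 < m)
    (hq : ∀ r, 0 < r → r < T' → HasDerivAt q (q' r) r)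
    (hqL : ∀ r, 0 < r → r < T' → |q' r| ≤ L)
    (hv : ∀ r, 0 < r → r < T' → HasDerivAt v (v' r) r)
    (hvV : ∀ r, 0 < r → r < T' → |v' r| ≤ V)
    (hvm : ∀ r, 0 < r → r < T' → m ≤ v r) (hvM : ∀ r, 0 < r → r < T' → v r ≤ M)
    (hA : ∀ s t, |A s t| ≤ 1)
    (hAs : ∀ s t, 0 < s → s < t → t < T' →
      HasDerivAt (fun r => A r t) (1 / 2 * gaussKernel (t - s) (q t - q s) * v s) s)
    (hAt : ∀ s t, 0 < s → s < t → t < T' →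
      HasDerivAt (fun r => A s r)
        (-(1 / 2) * gaussKernel (t - s) (q t - q s) * v s + Rm s t) t)
    (hRm : ∀ s t, 0 < s → s < t → t < T' → |Rm s t| ≤ V)
    (hV0 : 0 ≤ V) (hM0 : 0 < M) :
    ∃ δ > (0 : ℝ), ∃ C₁ > (0 : ℝ), ∃ C₂ > (0 : ℝ), ∀ s t : ℝ, 0 < s → s < t → t ≤ T →
      t - s < δ →
      (∃ ds : ℝ, HasDerivAt (fun s' => A s' t / (v s' * v t)) ds s ∧
        C₁ * (t - s) ^ (-(1 : ℝ) / 2) ≤ ds ∧ ds ≤ C₂ * (t - s) ^ (-(1 : ℝ) / 2)) ∧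
      (∃ dt : ℝ, HasDerivAt (fun t' => A s t' / (v s * v t')) dt t ∧
        -(C₂ * (t - s) ^ (-(1 : ℝ) / 2)) ≤ dt ∧ dt ≤ -(C₁ * (t - s) ^ (-(1 : ℝ) / 2))) ∧
      (∃ dst : ℝ, HasDerivAt (fun t' => deriv (fun s' => A s' t' / (v s' * v t')) s) dst t ∧
        -(C₂ * (t - s) ^ (-(3 : ℝ) / 2)) ≤ dst ∧ dst ≤ -(C₁ * (t - s) ^ (-(3 : ℝ) / 2))) := by
  set n := m⁻¹ with hn
  have hn0 : 0 < n := inv_pos.2 hm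
  set K := V * n ^ 2 + 2 * (V * n ^ 3) + 3 / 4 * L ^ 2 * n + 1 / 2 * (V * n ^ 2) +
    (1 / 2 * M + V) * V * n ^ 3 + V ^ 2 * n ^ 4 with hK
  have hVn2 : 0 ≤ V * n ^ 2 := by positivity
  have hVn3 : 0 ≤ V * n ^ 3 := by positivity
  have hK1 : V * n ^ 2 + 2 * (V * n ^ 3) ≤ K := by
    rw [hK]
    simp only [add_assoc]
    gcongr
    exact le_add_of_nonneg_right (by positivity)
  set c := gaussDensity L with hc
  have hc0 : 0 < c := gaussDensity_pos L
  have hK0 : 0 ≤ K := by positivity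
  set X := 1 + 8 * M * K / c with hX
  have hXp : 1 ≤ X := by
    have : 0 ≤ 8 * M * K / c := by positivity
    linarith
  have hX0 : 0 < X := by linarith
  refine ⟨(X ^ 2)⁻¹, by positivity, c / (8 * M), by positivity, 1 / m + K, by positivity,
    fun s t hs hst htT hδ => ?_⟩
  have ht : 0 < t := hs.trans hst
  have htT' : t < T' := htT.trans_lt hT
  have hsT' : s < T' := hst.trans htT'
  have hτ : 0 < t - s := sub_pos.2 hst
  set τ := t - s with hτdef
  have hsq : 0 < √τ := Real.sqrt_pos.2 hτ
  set x := (√τ)⁻¹ with hx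
  have hx0 : 0 < x := inv_pos.2 hsq
  have hx2 : x ^ 2 = τ⁻¹ := by rw [hx, inv_pow, Real.sq_sqrt hτ.le]
  have hXx : X ≤ x := by
    refine le_of_sq_le_sq ?_ hx0.le
    rw [hx2]
    exact (le_inv_comm₀ (by positivity) hτ).2 hδ.le
  have hx1 : 1 ≤ x := hXp.trans hXx
  have hKx : 8 * M * K / c ≤ x := by linarith
  have hτ1 : τ ≤ 1 := hδ.le.trans (inv_le_one_of_one_le₀ (one_le_pow₀ hXp))
  have e1 : τ ^ (-(1 : ℝ) / 2) = x := by
    rw [neg_div, rpow_neg hτ.le, hx, Real.sqrt_eq_rpow]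
  have e3 : τ ^ (-(3 : ℝ) / 2) = x ^ 2 * x := by
    rw [show -(3 : ℝ) / 2 = -(1 : ℝ) / 2 + (-1) by norm_num, rpow_add hτ, e1, rpow_neg_one, hx2]
    ring
  rw [e1, e3]
  have hΔ : |q t - q s| ≤ L * τ := abs_sub_le_of_hasDerivAt hst.le
    (fun r hr => hq r (hs.trans_le hr.1) (hr.2.trans_lt htT'))
    (fun r hr => hqL r (hs.trans_le hr.1) (hr.2.trans_lt htT'))
  set k := gaussKernel τ (q t - q s) with hk
  have hkl : c * x ≤ k := gaussDensity_mul_le_gaussKernel hτ hτ1 hΔ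
  have hku : k ≤ x := gaussKernel_le _ _
  have hk0 : 0 ≤ k := gaussKernel_nonneg _ _
  have hvs : 0 < v s := hm.trans_le (hvm s hs hsT')
  have hvt : 0 < v t := hm.trans_le (hvm t ht htT')
  have ha : (v s)⁻¹ ≤ n := inv_anti₀ hm (hvm s hs hsT')
  have hb : (v t)⁻¹ ≤ n := inv_anti₀ hm (hvm t ht htT')
  have ha0 : 0 < (v s)⁻¹ := inv_pos.2 hvs
  have hb0 : 0 < (v t)⁻¹ := inv_pos.2 hvt
  have hVs := hvV s hs hsT'
  have hVt := hvV t ht htT'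
  have hAst := hA s t
  have hR := hRm s t hs hst htT'
  refine ⟨?_, ?_, ?_⟩
  · refine ⟨_, hasDerivAt_left_quotient hvs.ne' hvt.ne' (hv s hs hsT') (hAs s t hs hst htT'), ?_⟩
    have hE : |A s t * (v' s * (v s)⁻¹ ^ 2) * (v t)⁻¹| ≤ K * 1 := by
      rw [abs_mul, abs_mul, abs_mul, abs_of_pos hb0, abs_of_pos (pow_pos ha0 2)]
      calc _ ≤ 1 * (V * n ^ 2) * n := by gcongr
        _ = V * n ^ 3 := by ring
        _ ≤ K * 1 := by linarith
    obtain ⟨b1, b2⟩ := bounds_aux hm hc0 hx1 hKx one_pos (hvm t ht htT') (hvM t ht htT') hkl hku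
      hK0 hE (one_mul x).symm
    have : 0 ≤ k * (v t)⁻¹ := by positivity
    constructor <;> linarith
  · refine ⟨_, hasDerivAt_right_quotient hvs.ne' hvt.ne' (hv t ht htT') (hAt s t hs hst htT'), ?_⟩
    have hE : |Rm s t * (v s)⁻¹ * (v t)⁻¹ - A s t * (v s)⁻¹ * (v' t * (v t)⁻¹ ^ 2)| ≤ K * 1 := by
      refine (abs_sub _ _).trans ?_
      simp only [abs_mul, abs_of_pos hb0, abs_of_pos ha0, abs_of_pos (pow_pos hb0 2)]
      calc _ ≤ V * n * n + 1 * n * (V * n ^ 2) := by gcongr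
        _ = V * n ^ 2 + V * n ^ 3 := by ring
        _ ≤ K * 1 := by linarith
    obtain ⟨b1, b2⟩ := bounds_aux hm hc0 hx1 hKx one_pos (hvm t ht htT') (hvM t ht htT') hkl hku
      hK0 hE (one_mul x).symm
    have h0 : 0 ≤ k * (v t)⁻¹ := by positivity
    have h1 : (-(1 / 2) * k * v s + Rm s t) * (v s)⁻¹ * (v t)⁻¹ =
        -(k * 1 * (v t)⁻¹ / 2) + Rm s t * (v s)⁻¹ * (v t)⁻¹ := by field_simp
    rw [h1]
    constructor <;> linarith
  · have hev : (fun t' => deriv (fun s' => A s' t' / (v s' * v t')) s) =ᶠ[𝓝 t] fun t' =>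
        1 / 2 * gaussKernel (t' - s) (q t' - q s) * (v t')⁻¹ -
          A s t' * (v' s * (v s)⁻¹ ^ 2) * (v t')⁻¹ := by
      filter_upwards [eventually_gt_nhds hst, eventually_lt_nhds htT'] with r hr hrT
      exact (hasDerivAt_left_quotient hvs.ne' (hm.trans_le (hvm r (hs.trans hr) hrT)).ne'
        (hv s hs hsT') (hAs s r hs hr hrT)).deriv
    have hkd := HasDerivAt.gaussKernel ((hq t ht htT').sub_const (q s))
      ((hasDerivAt_id t).sub_const s) (by exact hτ)
    have hvi := (hv t ht htT').inv hvt.ne'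
    have hD := (((hkd.const_mul (1 / 2)).mul hvi).sub
      (((hAt s t hs hst htT').mul_const (v' s * (v s)⁻¹ ^ 2)).mul hvi)).congr_of_eventuallyEq hev
    refine ⟨_, hD, ?_⟩
    simp only [id, Pi.inv_apply, ← hτdef, ← hk]
    set Δ := q t - q s
    set E := 1 / 2 * k * (Δ ^ 2 / (2 * τ ^ 2) - Δ * q' t / τ) * (v t)⁻¹ -
      1 / 2 * k * (v' t * (v t)⁻¹ ^ 2) -
      (-(1 / 2) * k * v s + Rm s t) * (v' s * (v s)⁻¹ ^ 2) * (v t)⁻¹ +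
      A s t * (v' s * (v s)⁻¹ ^ 2) * (v' t * (v t)⁻¹ ^ 2) with hEdef
    have hE : |E| ≤ K * x ^ 2 := by
      refine (abs_mixed_remainder_le hτ hΔ (hqL t ht htT') hk0 hku hx1 hvs (hvM s hs hsT') ha0 ha
        hb0 hb hVs hVt hAst hR).trans ?_
      gcongr
      rw [hK]
      linarith
    obtain ⟨b1, b2⟩ := bounds_aux hm hc0 hx1 hKx (pow_pos hx0 2) (hvm t ht htT')
      (hvM t ht htT') hkl hku hK0 hE rfl
    have h0 : 0 ≤ k * x ^ 2 * (v t)⁻¹ := by positivity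
    have h1 : 1 / 2 * (k * (-1 / (2 * τ) - Δ * q' t / τ + Δ ^ 2 * 1 / (2 * τ ^ 2))) * (v t)⁻¹ +
        1 / 2 * k * (-v' t / v t ^ 2) -
        ((-(1 / 2) * k * v s + Rm s t) * (v' s * (v s)⁻¹ ^ 2) * (v t)⁻¹ +
          A s t * (v' s * (v s)⁻¹ ^ 2) * (-v' t / v t ^ 2)) =
        -(k * x ^ 2 * (v t)⁻¹ / 4) + E := by
      rw [hEdef, hx2]
      field_simp
      ring
    rw [h1]
    constructor <;> linarith

end NearDiagonal

/-! ### Quantile curves -/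

/-- A `C³` function `f` with derivatives `f₁`, `f₂`, `f₃`, the first three of the four functions
decaying like `x⁻²` and the last one bounded. -/
structure DecayC3 (f f₁ f₂ f₃ : ℝ → ℝ) (C : ℝ) : Prop where
  hasDerivAt : ∀ x, HasDerivAt f (f₁ x) x
  hasDerivAt₁ : ∀ x, HasDerivAt f₁ (f₂ x) x
  hasDerivAt₂ : ∀ x, HasDerivAt f₂ (f₃ x) x
  continuous₃ : Continuous f₃
  decay : ∀ x, |f x| ≤ C * (1 + x ^ 2)⁻¹
  decay₁ : ∀ x, |f₁ x| ≤ C * (1 + x ^ 2)⁻¹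
  decay₂ : ∀ x, |f₂ x| ≤ C * (1 + x ^ 2)⁻¹
  bound₃ : ∀ x, |f₃ x| ≤ C

theorem mul_inv_one_add_sq_le {C : ℝ} (hC : 0 ≤ C) (x : ℝ) : C * (1 + x ^ 2)⁻¹ ≤ C :=
  mul_le_of_le_one_right hC (inv_le_one_of_one_le₀ (le_add_of_nonneg_right (sq_nonneg x)))

theorem SchwartzMap.exists_decayC3 (f : SchwartzMap ℝ ℝ) :
    ∃ f₁ f₂ f₃ C, DecayC3 f f₁ f₂ f₃ C := by
  let D := SchwartzMap.derivCLM ℝ ℝ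
  obtain ⟨C₀, h0⟩ := f.exists_decay
  obtain ⟨C₁, h1⟩ := (D f).exists_decay
  obtain ⟨C₂, h2⟩ := (D (D f)).exists_decay
  obtain ⟨C₃, h3⟩ := (D (D (D f))).exists_decay
  have hder : ∀ (g : SchwartzMap ℝ ℝ) x, HasDerivAt g (D g x) x := fun g x => g.hasDerivAt x
  have hle : ∀ {a b : ℝ}, a ≤ b → ∀ x : ℝ, a * (1 + x ^ 2)⁻¹ ≤ b * (1 + x ^ 2)⁻¹ :=
    fun h x => mul_le_mul_of_nonneg_right h (by positivity)
  have hC₃ : 0 ≤ C₃ := by simpa using (abs_nonneg _).trans (h3 0)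
  refine ⟨D f, D (D f), D (D (D f)), max (max C₀ C₁) (max C₂ C₃), hder _, hder _, hder _,
    (D (D (D f))).continuous, fun x => (h0 x).trans (hle (by simp) x),
    fun x => (h1 x).trans (hle (by simp) x), fun x => (h2 x).trans (hle (by simp) x),
    fun x => (h3 x).trans ((mul_inv_one_add_sq_le hC₃ x).trans (by simp))⟩

theorem abs_setIntegral_gaussKernel_mul_le {g : ℝ → ℝ} {G τ : ℝ} (hτ : 0 < τ)
    (hg : ∀ x, |g x| ≤ G) (a b : ℝ) :
    |∫ x in Iic a, gaussKernel τ (b - x) * g x| ≤ G := by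
  have hi : Integrable fun x => gaussKernel τ (b - x) * G :=
    ((integrable_gaussKernel hτ).comp_sub_left b).mul_const G
  have hG : 0 ≤ G := (abs_nonneg _).trans (hg 0)
  calc _ ≤ ∫ x in Iic a, gaussKernel τ (b - x) * G :=
        norm_integral_le_of_norm_le (f := fun x => gaussKernel τ (b - x) * g x)
          hi.integrableOn (ae_of_all _ fun x => by
          rw [Real.norm_eq_abs, abs_mul, abs_of_nonneg (gaussKernel_nonneg _ _)]
          exact mul_le_mul_of_nonneg_left (hg x) (gaussKernel_nonneg _ _))
    _ ≤ ∫ x, gaussKernel τ (b - x) * G :=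
        setIntegral_le_integral hi
          (ae_of_all _ fun x => mul_nonneg (gaussKernel_nonneg _ _) hG)
    _ = G := by
        rw [integral_mul_const, integral_sub_left_eq_self, integral_gaussKernel hτ, one_mul]

namespace DecayC3

variable {f f₁ f₂ f₃ q : ℝ → ℝ} {C α : ℝ}

theorem nonneg (D : DecayC3 f f₁ f₂ f₃ C) : 0 ≤ C := (abs_nonneg _).trans (D.bound₃ 0)

theorem boundedC2 (D : DecayC3 f f₁ f₂ f₃ C) : BoundedC2 f f₁ f₂ C where
  hasDerivAt := D.hasDerivAt
  hasDerivAt' := D.hasDerivAt₁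
  continuous_snd := continuous_iff_continuousAt.2 fun x => (D.hasDerivAt₂ x).continuousAt
  bound x := (D.decay x).trans (mul_inv_one_add_sq_le D.nonneg x)
  bound' x := (D.decay₁ x).trans (mul_inv_one_add_sq_le D.nonneg x)
  bound_snd x := (D.decay₂ x).trans (mul_inv_one_add_sq_le D.nonneg x)

theorem boundedC2_deriv (D : DecayC3 f f₁ f₂ f₃ C) : BoundedC2 f₁ f₂ f₃ C where
  hasDerivAt := D.hasDerivAt₁
  hasDerivAt' := D.hasDerivAt₂
  continuous_snd := D.continuous₃
  bound := D.boundedC2.bound'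
  bound' := D.boundedC2.bound_snd
  bound_snd := D.bound₃

theorem integrable (D : DecayC3 f f₁ f₂ f₃ C) : Integrable f :=
  integrable_of_continuous_of_decay D.boundedC2.continuous D.decay

theorem boundedC2_integral (D : DecayC3 f f₁ f₂ f₃ C) :
    BoundedC2 (fun w => ∫ z in Iic w, f z) f f₁ (max (∫ z, |f z|) C) where
  hasDerivAt := hasDerivAt_integral_Iic D.boundedC2.continuous D.integrable
  hasDerivAt' := D.hasDerivAt
  continuous_snd := D.boundedC2.continuous'
  bound _ := le_max_of_le_left <| (abs_integral_le_integral_abs).trans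
    (setIntegral_le_integral D.integrable.abs (ae_of_all _ fun _ => abs_nonneg _))
  bound' x := le_max_of_le_right (D.boundedC2.bound x)
  bound_snd x := le_max_of_le_right (D.boundedC2.bound' x)

theorem setIntegral_Iic_gaussAvg (D : DecayC3 f f₁ f₂ f₃ C) {t : ℝ} (ht : 0 ≤ t) (r : ℝ) :
    ∫ x in Iic r, gaussAvg f x t = gaussAvg (fun w => ∫ z in Iic w, f z) r t :=
  _root_.setIntegral_Iic_gaussAvg D.boundedC2_integral (tendsto_integral_Iic_atBot D.integrable)
    D.decay ht r

theorem exists_decay_gaussAvg (D : DecayC3 f f₁ f₂ f₃ C) {T : ℝ} (hT : 0 ≤ T) :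
    ∃ K, (∀ x t, t ≤ T → |gaussAvg f x t| ≤ K * (1 + x ^ 2)⁻¹) ∧
      (∀ x t, t ≤ T → |gaussAvg f₁ x t| ≤ K * (1 + x ^ 2)⁻¹) ∧
      ∀ x t, t ≤ T → |gaussAvg f₂ x t| ≤ K * (1 + x ^ 2)⁻¹ := by
  obtain ⟨K₀, h0⟩ := abs_gaussAvg_le_of_decay D.decay hT
  obtain ⟨K₁, h1⟩ := abs_gaussAvg_le_of_decay D.decay₁ hT
  obtain ⟨K₂, h2⟩ := abs_gaussAvg_le_of_decay D.decay₂ hT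
  have hle : ∀ {a b : ℝ}, a ≤ b → ∀ x : ℝ, a * (1 + x ^ 2)⁻¹ ≤ b * (1 + x ^ 2)⁻¹ :=
    fun h x => mul_le_mul_of_nonneg_right h (by positivity)
  exact ⟨max K₀ (max K₁ K₂), fun x t ht => (h0 x t ht).trans (hle (by simp) x),
    fun x t ht => (h1 x t ht).trans (hle (by simp) x),
    fun x t ht => (h2 x t ht).trans (hle (by simp) x)⟩

theorem continuousOn_quantile (D : DecayC3 f f₁ f₂ f₃ C) (hf : ∀ x, 0 ≤ f x)
    (hq : ∀ t, 0 ≤ t → ∫ x in Iic (q t), gaussAvg f x t = α)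
    (huniq : ∀ t, 0 ≤ t → ∀ r, ∫ x in Iic r, gaussAvg f x t = α → r = q t) :
    ContinuousOn q (Ici 0) := by
  have H := D.boundedC2_integral
  refine _root_.continuousOn_quantile (α := α) (continuous_gaussAvg H.continuous H.bound)
    (fun t _ => monotone_of_hasDerivAt_nonneg (fun r => H.hasDerivAt_gaussAvg r t) fun r =>
      integral_nonneg fun z => mul_nonneg (hf _) (gaussDensity_pos z).le)
    (fun t ht => ?_) (fun t ht r hr => huniq t ht r ?_)
  · rw [← D.setIntegral_Iic_gaussAvg ht, hq t ht]
  · rw [D.setIntegral_Iic_gaussAvg ht, hr]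

theorem hasDerivAt_quantile (D : DecayC3 f f₁ f₂ f₃ C)
    (hq : ∀ t, 0 ≤ t → ∫ x in Iic (q t), gaussAvg f x t = α) (hqc : ContinuousOn q (Ici 0))
    {t : ℝ} (ht : 0 < t) (hu : gaussAvg f (q t) t ≠ 0) :
    HasDerivAt q (-(1 / 2 * gaussAvg f₁ (q t) t) / gaussAvg f (q t) t) t := by
  have H := D.boundedC2_integral
  refine _root_.hasDerivAt_quantile (u := gaussAvg f) (α := α)
    (fun r s => H.hasDerivAt_gaussAvg r s)
    (continuous_gaussAvg D.boundedC2.continuous D.boundedC2.bound) hu ?_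
    (hqc.continuousAt (Ici_mem_nhds ht)) ?_
  · refine (H.hasDerivAt_gaussAvg_curve (c := fun _ => q t) (c' := fun _ => 0) (L := 0) ht
      (Eventually.of_forall fun s => ⟨hasDerivAt_const _ _, by simp⟩)).congr_deriv (by simp)
  · filter_upwards [eventually_gt_nhds ht] with s hs
    rw [← D.setIntegral_Iic_gaussAvg hs.le, hq s hs.le]

theorem exists_gaussAvg_quantile_lower_bound (D : DecayC3 f f₁ f₂ f₃ C) (hf : ∀ x, 0 ≤ f x)
    (hf0 : 0 < f (q 0)) (hqc : ContinuousOn q (Ici 0)) {T : ℝ} (hT : 0 ≤ T) :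
    ∃ m > 0, ∀ t ∈ Icc 0 T, m ≤ gaussAvg f (q t) t := by
  have hcont : ContinuousOn (fun t => gaussAvg f (q t) t) (Icc 0 T) :=
    (continuous_gaussAvg D.boundedC2.continuous D.boundedC2.bound).comp_continuousOn
      ((hqc.mono Icc_subset_Ici_self).prodMk continuousOn_id)
  obtain ⟨t₀, ht₀, hmin⟩ := isCompact_Icc.exists_isMinOn (nonempty_Icc.2 hT) hcont
  refine ⟨_, ?_, fun t ht => hmin ht⟩
  rcases ht₀.1.eq_or_lt with h | h
  · rw [← h]
    simpa [← udens_eq_gaussAvg f _ le_rfl, udens] using hf0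
  · exact gaussAvg_pos D.boundedC2.continuous D.boundedC2.bound hf hf0 _ h

end DecayC3

/-- Bounds on the partial derivatives `∂ₛρ`, `∂ₜρ` and `∂²ₛₜρ` near the
diagonal: they are of order `|t−s|^{-1/2}`, `−|t−s|^{-1/2}` and `−|t−s|^{-3/2}` respectively. -/
theorem rho_partial_derivative_bounds
    {Ω : Type*} [MeasurableSpace Ω] (P : Measure Ω) [IsProbabilityMeasure P]
    (f : SchwartzMap ℝ ℝ) (hf_nonneg : ∀ x, 0 ≤ f x) (hf_prob : ∫ x : ℝ, f x = 1)
    (α : ℝ) (hα : α ∈ Set.Ioo (0 : ℝ) 1)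
    (q : ℝ → ℝ)
    (hq : ∀ t, 0 ≤ t → ∫ x in Set.Iic (q t), udens (⇑f) x t = α)
    (hq_unique : ∀ t, 0 ≤ t → ∀ r : ℝ, (∫ x in Set.Iic r, udens (⇑f) x t = α) → r = q t)
    (hfq0 : 0 < f (q 0))
    (B : ℝ → Ω → ℝ) (hB_meas : ∀ t, Measurable (B t))
    (hBmarg : ∀ t, 0 ≤ t → ∀ a : ℝ,
      (P {ω | B t ω ≤ a}).toReal = ∫ x in Set.Iic a, udens (⇑f) x t)
    (hBjoint : ∀ s t : ℝ, 0 ≤ s → s < t → ∀ a b : ℝ,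
      (P {ω | B s ω ≤ a ∧ B t ω ≤ b}).toReal
        = ∫ x in Set.Iic a, (∫ y in Set.Iic b, heatKernel (t - s) x y) * udens (⇑f) x s)
    (T : ℝ) (hT : 0 < T) :
    ∃ δ > (0 : ℝ), ∃ C₁ > (0 : ℝ), ∃ C₂ > (0 : ℝ), ∀ s t : ℝ, 0 < s → s < t → t ≤ T →
      t - s < δ →
      (∃ ds : ℝ, HasDerivAt (fun s' => rho P B (⇑f) q α s' t) ds s ∧
        C₁ * (t - s) ^ (-(1 : ℝ) / 2) ≤ ds ∧ ds ≤ C₂ * (t - s) ^ (-(1 : ℝ) / 2)) ∧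
      (∃ dt : ℝ, HasDerivAt (fun t' => rho P B (⇑f) q α s t') dt t ∧
        -(C₂ * (t - s) ^ (-(1 : ℝ) / 2)) ≤ dt ∧ dt ≤ -(C₁ * (t - s) ^ (-(1 : ℝ) / 2))) ∧
      (∃ dst : ℝ, HasDerivAt (fun t' => deriv (fun s' => rho P B (⇑f) q α s' t') s) dst t ∧
        -(C₂ * (t - s) ^ (-(3 : ℝ) / 2)) ≤ dst ∧ dst ≤ -(C₁ * (t - s) ^ (-(3 : ℝ) / 2))) := by
  obtain ⟨f₁, f₂, f₃, C, D⟩ := f.exists_decayC3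
  have hu : ∀ {t : ℝ}, 0 ≤ t → (fun x => udens f x t) = fun x => gaussAvg f x t :=
    fun ht => funext fun x => udens_eq_gaussAvg f x ht
  have hq' : ∀ t, 0 ≤ t → ∫ x in Iic (q t), gaussAvg f x t = α := fun t ht => by
    rw [← hq t ht, hu ht]
  have hqc : ContinuousOn q (Ici 0) := D.continuousOn_quantile hf_nonneg hq' fun t ht r hr =>
    hq_unique t ht r (by rw [hu ht, hr])
  have hT' : 0 ≤ T + 1 := by linarith
  obtain ⟨m, hm, hmin⟩ := D.exists_gaussAvg_quantile_lower_bound hf_nonneg hfq0 hqc hT'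
  have hC0 := D.nonneg
  have h0 : ∀ x t, |gaussAvg f x t| ≤ C := abs_gaussAvg_le D.boundedC2.bound
  have h1 : ∀ x t, |gaussAvg f₁ x t| ≤ C := abs_gaussAvg_le D.boundedC2.bound'
  have h2 : ∀ x t, |gaussAvg f₂ x t| ≤ C := abs_gaussAvg_le D.boundedC2.bound_snd
  have hCpos : 0 < C := hm.trans_le
    ((hmin 0 ⟨le_rfl, hT'⟩).trans ((le_abs_self _).trans (h0 _ _)))
  have hlow : ∀ r, 0 < r → r < T + 1 → m ≤ gaussAvg f (q r) r :=
    fun r hr hrT => hmin r ⟨hr.le, hrT.le⟩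
  set q' : ℝ → ℝ := fun t => -(1 / 2 * gaussAvg f₁ (q t) t) / gaussAvg f (q t) t with hq'def
  set L := 1 / 2 * C / m with hLdef
  have hL0 : 0 ≤ L := by positivity
  have hqd : ∀ r, 0 < r → r < T + 1 → HasDerivAt q (q' r) r := fun r hr hrT =>
    D.hasDerivAt_quantile hq' hqc hr (hm.trans_le (hlow r hr hrT)).ne'
  have hqL : ∀ r, 0 < r → r < T + 1 → |q' r| ≤ L := fun r hr hrT => by
    have hpos := hm.trans_le (hlow r hr hrT)
    rw [hq'def, abs_div, abs_neg, abs_mul, abs_of_pos (one_half_pos (α := ℝ)), abs_of_pos hpos]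
    exact div_le_div₀ (by positivity) (mul_le_mul_of_nonneg_left (h1 _ _) one_half_pos.le) hm
      (hlow r hr hrT)
  have hqev : ∀ r, 0 < r → r < T + 1 → ∀ᶠ s in 𝓝 r, HasDerivAt q (q' s) s ∧ |q' s| ≤ L :=
    fun r hr hrT => by
      filter_upwards [eventually_gt_nhds hr, eventually_lt_nhds hrT] with s hs hsT
      exact ⟨hqd s hs hsT, hqL s hs hsT⟩
  have hbd : ∀ {p a b : ℝ}, |p| ≤ L → |a| ≤ C → |b| ≤ C → |p * a + 1 / 2 * b| ≤ L * C + 1 / 2 * C :=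
    fun hp ha hb => (abs_add_le _ _).trans (by
      rw [abs_mul, abs_mul, abs_of_pos (one_half_pos (α := ℝ))]
      gcongr)
  have hα2 : 0 ≤ α ^ 2 ∧ α ^ 2 ≤ 1 := ⟨sq_nonneg α, pow_le_one₀ hα.1.le hα.2.le⟩
  have hjoint : ∀ s t, 0 < s → s < t → (P {ω | B s ω ≤ q s ∧ B t ω ≤ q t}).toReal - α ^ 2 =
      (∫ x in Iic (q s), gaussCdf ((q t - x) / √(t - s)) * gaussAvg f x s) - α ^ 2 := by
    intro s t hs hst
    rw [hBjoint s t hs.le hst]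
    simp only [setIntegral_Iic_heatKernel (sub_pos.2 hst), udens_eq_gaussAvg f _ hs.le]
  refine quotient_partial_derivative_bounds (q := q) (q' := q') (v := fun s => udens f (q s) s)
    (v' := fun t => q' t * gaussAvg f₁ (q t) t + 1 / 2 * gaussAvg f₂ (q t) t)
    (A := fun s t => (P {ω | B s ω ≤ q s ∧ B t ω ≤ q t}).toReal - α ^ 2)
    (Rm := fun s t => ∫ x in Iic (q s), gaussKernel (t - s) (q t - x) *
      (1 / 2 * gaussAvg f₁ x s + q' t * gaussAvg f x s))
    (V := L * C + 1 / 2 * C) (lt_add_one T) hm hqd hqL (fun r hr hrT => ?_)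
    (fun r hr hrT => hbd (hqL r hr hrT) (h1 _ _) (h2 _ _))
    (fun r hr hrT => (udens_eq_gaussAvg f _ hr.le).symm ▸ hlow r hr hrT)
    (fun r hr _ => (udens_eq_gaussAvg f _ hr.le).symm ▸ (le_abs_self _).trans (h0 _ _))
    (fun s t => ?_) (fun s t hs hst htT => ?_) (fun s t hs hst htT => ?_)
    (fun s t hs hst htT => ?_) (by positivity) hCpos
  · refine (D.boundedC2.hasDerivAt_gaussAvg_curve hr (hqev r hr hrT)).congr_of_eventuallyEq ?_
    filter_upwards [eventually_gt_nhds hr] with s hs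
    exact udens_eq_gaussAvg f _ hs.le
  · have hp : (P {ω | B s ω ≤ q s ∧ B t ω ≤ q t}).toReal ≤ 1 := measureReal_le_one
    have hp0 : 0 ≤ (P {ω | B s ω ≤ q s ∧ B t ω ≤ q t}).toReal := ENNReal.toReal_nonneg
    exact abs_le.2 ⟨by linarith, by linarith⟩
  · obtain ⟨K, k0, k1, k2⟩ := D.exists_decay_gaussAvg (hs.trans hst).le
    have hsT := hst.trans htT
    have hpos := hm.trans_le (hlow s hs hsT)
    refine (((hasDerivAt_setIntegral_gaussCdf_left D.boundedC2 D.boundedC2_deriv k0 k1 k2 hs hst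
      (hqev s hs hsT) (q t)).sub_const (α ^ 2)).congr_of_eventuallyEq ?_).congr_deriv ?_
    · filter_upwards [eventually_gt_nhds hs, eventually_lt_nhds hst] with r hr hrt
      exact hjoint r t hr hrt
    · have hflux : q' s * gaussAvg f (q s) s + 1 / 2 * gaussAvg f₁ (q s) s = 0 := by
        rw [hq'def, div_mul_cancel₀ _ hpos.ne', neg_add_cancel]
      rw [hflux, mul_zero, zero_add, udens_eq_gaussAvg f _ hs.le]
  · obtain ⟨K, k0, k1, k2⟩ := D.exists_decay_gaussAvg hs.le
    refine (((hasDerivAt_setIntegral_gaussCdf_right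
      (fun x => D.boundedC2.hasDerivAt_gaussAvg x s)
      ((continuous_gaussAvg D.boundedC2.continuous' D.boundedC2.bound').comp
        (by fun_prop : Continuous fun x => (x, s)))
      (fun x => k0 x s le_rfl) (fun x => k1 x s le_rfl) hst (hqev t (hs.trans hst) htT)
      (q s)).sub_const (α ^ 2)).congr_of_eventuallyEq ?_).congr_deriv ?_
    · filter_upwards [eventually_gt_nhds hst] with r hr
      exact hjoint s r hs hr
    · rw [udens_eq_gaussAvg f _ hs.le]
  · refine abs_setIntegral_gaussKernel_mul_le (sub_pos.2 hst) (fun x => ?_) _ _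
    rw [add_comm]
    exact hbd (hqL t (hs.trans hst) htT) (h0 _ _) (h1 _ _)
end

section
/- Fix T > 0. There exist positive constants C_1, C_2 such that C_1|t − s|^{1/2} ≤ ρ(t,t) + ρ(s,s) − 2ρ(s,t) ≤ C_2|t − s|^{1/2} for all s, t ∈ [0,T]. (Equivalently, C_1|t − s|^{1/2} ≤ E|F(t) − F(s)|² ≤ C_2|t − s|^{1/2} for any centered Gaussian process F with covariance ρ.) -/
open MeasureTheory Real Set Filter

open ProbabilityTheory

/-- An affine image of the standard Gaussian measure is Gaussian. -/
lemma gaussianReal_map_affine (x c : ℝ) :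
    (gaussianReal 0 1).map (fun z ↦ x + c * z) = gaussianReal x (.mk (c ^ 2) (sq_nonneg c)) := by
  have h : (fun z : ℝ ↦ x + c * z) = (fun z ↦ x + z) ∘ fun z ↦ c * z := rfl
  rw [h, ← Measure.map_map (by fun_prop) (by fun_prop), gaussianReal_map_const_mul,
    gaussianReal_map_const_add]
  simp

lemma heatKernel_eq_gaussianPDFReal {t : ℝ} (ht : 0 < t) (x y : ℝ) :
    heatKernel t x y = gaussianPDFReal x (.mk (√t ^ 2) (sq_nonneg _)) y := by
  simp only [heatKernel, gaussianPDFReal, NNReal.coe_mk, Real.sq_sqrt ht.le]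
  rw [← neg_sub y x, neg_sq]

lemma mk_sq_sqrt_ne_zero {t : ℝ} (ht : 0 < t) : NNReal.mk (√t ^ 2) (sq_nonneg _) ≠ 0 :=
  fun h ↦ (pow_pos (Real.sqrt_pos.2 ht) 2).ne' (congrArg NNReal.toReal h)

lemma udens_eq_integral_gaussian {f : ℝ → ℝ} (hf : Continuous f) (x : ℝ) {t : ℝ} (ht : 0 ≤ t) :
    udens f x t = ∫ z, f (x + √t * z) ∂gaussianReal 0 1 := by
  rcases ht.eq_or_lt with rfl | ht
  · simp [udens]
  rw [udens, if_neg ht.ne',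
    ← integral_map (f := f) (φ := fun z ↦ x + √t * z) (by fun_prop) hf.aestronglyMeasurable,
    gaussianReal_map_affine, integral_gaussianReal_eq_integral_smul (mk_sq_sqrt_ne_zero ht)]
  simp [heatKernel_eq_gaussianPDFReal ht]

lemma setIntegral_heatKernel_eq {t : ℝ} (ht : 0 < t) (x b : ℝ) :
    ∫ y in Iic b, heatKernel t x y = (gaussianReal 0 1).real {z | x + √t * z ≤ b} := by
  have h1 : (gaussianReal 0 1).real {z | x + √t * z ≤ b}
      = ((gaussianReal 0 1).map (fun z ↦ x + √t * z)).real (Iic b) := by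
    rw [map_measureReal_apply (by fun_prop) measurableSet_Iic]
    rfl
  rw [h1, gaussianReal_map_affine, Measure.real, gaussianReal_apply_eq_integral _ (mk_sq_sqrt_ne_zero ht),
    ENNReal.toReal_ofReal (integral_nonneg fun y ↦ gaussianPDFReal_nonneg _ _ _)]
  simp [heatKernel_eq_gaussianPDFReal ht]

lemma integral_abs_gaussianReal_le_one : ∫ z, |z| ∂gaussianReal 0 1 ≤ 1 := by
  have h2 : Integrable (fun z : ℝ ↦ z ^ 2) (gaussianReal 0 1) :=
    (memLp_id_gaussianReal 2).integrable_sq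
  have h1 : Integrable (fun z : ℝ ↦ |z|) (gaussianReal 0 1) :=
    ((memLp_id_gaussianReal 1).integrable le_rfl).abs
  have hsq : ∫ z, z ^ 2 ∂gaussianReal 0 1 = 1 := by
    have := variance_fun_id_gaussianReal (μ := 0) (v := 1)
    rw [variance_eq_integral (by fun_prop)] at this
    simpa using this
  calc ∫ z, |z| ∂gaussianReal 0 1 ≤ ∫ z, (1 + z ^ 2) / 2 ∂gaussianReal 0 1 := by
        refine integral_mono h1 (((integrable_const 1).add h2).div_const 2) fun z ↦ ?_
        have := sq_nonneg (|z| - 1)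
        have h3 := sq_abs z
        simp only
        nlinarith
    _ = 1 := by
        rw [integral_div, integral_add (integrable_const 1) h2, hsq]
        simp

lemma integrable_comp_affine_gaussian {g : ℝ → ℝ} (hg : Continuous g) {M : ℝ}
    (hM : ∀ x, |g x| ≤ M) (x c : ℝ) :
    Integrable (fun z ↦ g (x + c * z)) (gaussianReal 0 1) :=
  .of_bound (by fun_prop) M (ae_of_all _ fun z ↦ hM _)

/-- Gaussian averages of a bounded Lipschitz function are Lipschitz in space and
`1/2`-Hölder in time. -/
lemma abs_gaussian_average_sub_le {g : ℝ → ℝ} {L M : ℝ} (hL : 0 ≤ L)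
    (hg : Continuous g) (hM : ∀ x, |g x| ≤ M) (hlip : ∀ x y, |g x - g y| ≤ L * |x - y|)
    (x y : ℝ) {s t : ℝ} (hs : 0 ≤ s) (ht : 0 ≤ t) :
    |∫ z, g (x + √t * z) ∂gaussianReal 0 1 - ∫ z, g (y + √s * z) ∂gaussianReal 0 1|
      ≤ L * (|x - y| + √|t - s|) := by
  have hsqrt : |√t - √s| ≤ √|t - s| := by
    apply Real.le_sqrt_of_sq_le
    have h1 := Real.sq_sqrt hs
    have h2 := Real.sq_sqrt ht
    have e : t - s = (√t - √s) * (√t + √s) := by ring_nf; rw [h1, h2]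
    rw [e, abs_mul, sq]
    refine mul_le_mul_of_nonneg_left ?_ (abs_nonneg _)
    exact abs_sub_le_of_nonneg_of_le (Real.sqrt_nonneg t) (by simp) (Real.sqrt_nonneg s) (by simp)
      |>.trans (le_abs_self _)
  have habs : Integrable (fun z : ℝ ↦ |z|) (gaussianReal 0 1) :=
    ((memLp_id_gaussianReal 1).integrable le_rfl).abs
  rw [← integral_sub (integrable_comp_affine_gaussian hg hM x _)
    (integrable_comp_affine_gaussian hg hM y _)]
  calc _ ≤ ∫ z, L * (|x - y| + √|t - s| * |z|) ∂gaussianReal 0 1 := by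
        rw [← Real.norm_eq_abs]
        refine norm_integral_le_of_norm_le (((integrable_const _).add
          (habs.const_mul _)).const_mul L) (ae_of_all _ fun z ↦ ?_)
        refine (hlip _ _).trans (mul_le_mul_of_nonneg_left ?_ hL)
        calc |x + √t * z - (y + √s * z)| = |(x - y) + (√t - √s) * z| := by ring_nf
          _ ≤ |x - y| + |√t - √s| * |z| := by
            rw [← abs_mul]; exact abs_add_le _ _
          _ ≤ _ := by gcongr
    _ = L * (|x - y| + √|t - s| * ∫ z, |z| ∂gaussianReal 0 1) := by
        rw [integral_const_mul, integral_add (integrable_const _) (habs.const_mul _),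
          integral_const_mul]
        simp
    _ ≤ _ := by
        have := integral_abs_gaussianReal_le_one
        gcongr
        exact mul_le_of_le_one_right (Real.sqrt_nonneg _) this

/-- A nonnegative function that is at least `k` on an interval contained in the domain of
integration has integral at least `k` times the length of the interval. -/
lemma mul_sub_le_setIntegral {g : ℝ → ℝ} {S : Set ℝ}
    (hint : IntegrableOn g S) (hg : ∀ x, 0 ≤ g x) {k c d : ℝ} (hcd : c ≤ d)
    (hsub : Ioc c d ⊆ S) (hk : ∀ x ∈ Ioc c d, k ≤ g x) :
    k * (d - c) ≤ ∫ x in S, g x := by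
  calc k * (d - c) = ∫ _ in Ioc c d, k := by simp [hcd, mul_comm]
    _ ≤ ∫ x in Ioc c d, g x :=
        setIntegral_mono_on (by simp) (hint.mono_set hsub) measurableSet_Ioc hk
    _ ≤ ∫ x in S, g x :=
        setIntegral_mono_set hint (ae_of_all _ hg) hsub.eventuallyLE

lemma mul_min_le_abs_cdf_sub {u : ℝ → ℝ} {L m p : ℝ} (hL : 0 < L) (hm : 0 < m)
    (hu : Integrable u) (hu0 : ∀ x, 0 ≤ u x) (hlip : ∀ x y, |u x - u y| ≤ L * |x - y|)
    (hp : m ≤ u p) (x : ℝ) :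
    m / 2 * min |x - p| (m / (2 * L)) ≤ |(∫ y in Iic x, u y) - ∫ y in Iic p, u y| := by
  set r := min |x - p| (m / (2 * L)) with hr
  have hr0 : 0 ≤ r := le_min (abs_nonneg _) (by positivity)
  have hlow : ∀ y, |y - p| ≤ r → m / 2 ≤ u y := by
    intro y hy
    have h1 := hlip y p
    have h2 : L * |y - p| ≤ m / 2 := by
      calc L * |y - p| ≤ L * (m / (2 * L)) := by
            gcongr; exact hy.trans (min_le_right _ _)
        _ = m / 2 := by field_simp
    have h3 := neg_abs_le (u y - u p)
    linarith
  rcases le_total p x with h | h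
  · have hrx : r ≤ x - p := by
      rw [← abs_of_nonneg (sub_nonneg.2 h)]; exact min_le_left _ _
    rw [intervalIntegral.integral_Iic_sub_Iic hu.integrableOn hu.integrableOn,
      intervalIntegral.integral_of_le h]
    refine le_trans ?_ (le_abs_self _)
    have := mul_sub_le_setIntegral (S := Ioc p x) hu.integrableOn hu0
      (k := m / 2) (c := p) (d := p + r) (by linarith) (Ioc_subset_Ioc_right (by linarith))
      (fun y hy ↦ hlow y (by rw [abs_of_nonneg (by linarith [hy.1])]; linarith [hy.2]))
    simpa using this
  · have hrx : r ≤ p - x := by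
      rw [← abs_of_nonneg (sub_nonneg.2 h), abs_sub_comm]; exact min_le_left _ _
    rw [abs_sub_comm, intervalIntegral.integral_Iic_sub_Iic hu.integrableOn hu.integrableOn,
      intervalIntegral.integral_of_le h]
    refine le_trans ?_ (le_abs_self _)
    have := mul_sub_le_setIntegral (S := Ioc x p) hu.integrableOn hu0
      (k := m / 2) (c := p - r) (d := p) (by linarith) (Ioc_subset_Ioc_left (by linarith))
      (fun y hy ↦ hlow y (by rw [abs_of_nonpos (by linarith [hy.2])]; linarith [hy.1]))
    simpa using this

lemma integrable_comp_affine_prod {f : ℝ → ℝ} (hf : Continuous f) (hfi : Integrable f) (c : ℝ) :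
    Integrable (fun p : ℝ × ℝ ↦ f (p.1 + c * p.2)) (volume.prod (gaussianReal 0 1)) := by
  rw [integrable_prod_iff' (by fun_prop)]
  refine ⟨ae_of_all _ fun z ↦ hfi.comp_add_right (c * z), ?_⟩
  simp_rw [integral_add_right_eq_self (fun x ↦ ‖f x‖)]
  exact integrable_const _

lemma integrable_udens {f : ℝ → ℝ} (hf : Continuous f) (hfi : Integrable f) {t : ℝ} (ht : 0 ≤ t) :
    Integrable (fun x ↦ udens f x t) := by
  simp_rw [udens_eq_integral_gaussian hf _ ht]
  exact (integrable_comp_affine_prod hf hfi _).integral_prod_left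

lemma setIntegral_udens_eq {f : ℝ → ℝ} (hf : Continuous f) (hfi : Integrable f) {t : ℝ}
    (ht : 0 ≤ t) (x : ℝ) :
    ∫ y in Iic x, udens f y t
      = ∫ z, (∫ y in Iic (x + √t * z), f y) ∂gaussianReal 0 1 := by
  simp_rw [udens_eq_integral_gaussian hf _ ht]
  rw [integral_integral_swap]
  · congr with z
    have h := (measurePreserving_add_right volume (√t * z)).setIntegral_preimage_emb
      (measurableEmbedding_addRight _) f (Iic (x + √t * z))
    simpa using h
  · have h := (integrable_comp_affine_prod hf hfi (√t)).integrableOn (s := Iic x ×ˢ univ)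
    rw [IntegrableOn, ← Measure.prod_restrict, Measure.restrict_univ] at h
    exact h

lemma abs_setIntegral_udens_sub_le {f : ℝ → ℝ} {M : ℝ} (hf : Continuous f) (hfi : Integrable f)
    (hf0 : ∀ x, 0 ≤ f x) (hM : ∀ x, f x ≤ M) (x : ℝ) {s t : ℝ} (hs : 0 ≤ s) (ht : 0 ≤ t) :
    |(∫ y in Iic x, udens f y t) - ∫ y in Iic x, udens f y s| ≤ M * √|t - s| := by
  have hM0 : 0 ≤ M := (hf0 0).trans (hM 0)
  have hsub : ∀ a b, (∫ y in Iic a, f y) - ∫ y in Iic b, f y = ∫ y in b..a, f y := fun a b ↦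
    intervalIntegral.integral_Iic_sub_Iic hfi.integrableOn hfi.integrableOn
  have hlip : ∀ a b, |(∫ y in Iic a, f y) - ∫ y in Iic b, f y| ≤ M * |a - b| := by
    intro a b
    rw [hsub, ← Real.norm_eq_abs]
    exact intervalIntegral.norm_integral_le_of_norm_le_const fun y _ ↦ by
      rw [Real.norm_eq_abs, abs_of_nonneg (hf0 y)]; exact hM y
  have hcont : Continuous fun a ↦ ∫ y in Iic a, f y := by
    refine (LipschitzWith.of_dist_le_mul (K := M.toNNReal) fun a b ↦ ?_).continuous
    rw [Real.dist_eq, Real.dist_eq, Real.coe_toNNReal M hM0]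
    exact hlip a b
  have hbdd : ∀ a, |∫ y in Iic a, f y| ≤ ∫ y, f y := by
    intro a
    rw [abs_of_nonneg (integral_nonneg hf0)]
    exact setIntegral_le_integral hfi (ae_of_all _ hf0)
  rw [setIntegral_udens_eq hf hfi ht, setIntegral_udens_eq hf hfi hs]
  simpa using abs_gaussian_average_sub_le hM0 hcont hbdd hlip x x hs ht

lemma udens_nonneg {f : ℝ → ℝ} (hf : Continuous f) (hf0 : ∀ x, 0 ≤ f x) (x : ℝ) {t : ℝ}
    (ht : 0 ≤ t) : 0 ≤ udens f x t := by
  rw [udens_eq_integral_gaussian hf _ ht]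
  exact integral_nonneg fun z ↦ hf0 _

lemma udens_le {f : ℝ → ℝ} {M : ℝ} (hf : Continuous f) (hf0 : ∀ x, 0 ≤ f x)
    (hM : ∀ x, f x ≤ M) (x : ℝ) {t : ℝ} (ht : 0 ≤ t) : udens f x t ≤ M := by
  rw [udens_eq_integral_gaussian hf _ ht]
  calc _ ≤ ∫ _, M ∂gaussianReal 0 1 :=
        integral_mono (integrable_comp_affine_gaussian hf
          (fun y ↦ (abs_of_nonneg (hf0 y)).trans_le (hM y)) x _) (integrable_const _)
          fun z ↦ hM _
    _ = M := by simp

lemma abs_udens_sub_le {f : ℝ → ℝ} {L M : ℝ} (hL : 0 ≤ L) (hf : Continuous f)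
    (hM : ∀ x, |f x| ≤ M) (hlip : ∀ x y, |f x - f y| ≤ L * |x - y|) (x y : ℝ) {s t : ℝ}
    (hs : 0 ≤ s) (ht : 0 ≤ t) :
    |udens f x t - udens f y s| ≤ L * (|x - y| + √|t - s|) := by
  rw [udens_eq_integral_gaussian hf _ ht, udens_eq_integral_gaussian hf _ hs]
  exact abs_gaussian_average_sub_le hL hf hM hlip x y hs ht

instance isOpenPosMeasure_gaussianReal : (gaussianReal 0 1).IsOpenPosMeasure :=
  (gaussianReal_absolutelyContinuous' 0 one_ne_zero).isOpenPosMeasure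

lemma udens_pos {f : ℝ → ℝ} {M x₀ : ℝ} (hf : Continuous f) (hf0 : ∀ x, 0 ≤ f x)
    (hM : ∀ x, |f x| ≤ M) (hx₀ : f x₀ ≠ 0) (x : ℝ) {t : ℝ} (ht : 0 < t) :
    0 < udens f x t := by
  rw [udens_eq_integral_gaussian hf _ ht.le]
  have hs : √t ≠ 0 := (Real.sqrt_pos.2 ht).ne'
  refine integral_pos_of_integrable_nonneg_nonzero (x := (x₀ - x) / √t) (by fun_prop)
    (integrable_comp_affine_gaussian hf hM x _) (fun z ↦ hf0 _) ?_
  rwa [mul_div_cancel₀ _ hs, add_sub_cancel]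

/-- The probability that a Brownian motion at `x` exceeds `b` after time `h`. -/
noncomputable def exceedProb (h b x : ℝ) : ℝ := (gaussianReal 0 1).real {z | b < x + √h * z}

lemma exceedProb_nonneg (h b x : ℝ) : 0 ≤ exceedProb h b x := measureReal_nonneg

lemma exceedProb_le_one (h b x : ℝ) : exceedProb h b x ≤ 1 := measureReal_le_one

lemma exceedProb_mono (h b : ℝ) : Monotone (exceedProb h b) := fun x y hxy ↦
  measureReal_mono fun z (hz : b < x + √h * z) ↦ show b < y + √h * z by linarith

lemma setIntegral_heatKernel_eq_one_sub {h : ℝ} (hh : 0 < h) (x b : ℝ) :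
    ∫ y in Iic b, heatKernel h x y = 1 - exceedProb h b x := by
  rw [setIntegral_heatKernel_eq hh, exceedProb, ← probReal_compl_eq_one_sub
    (measurableSet_lt (by fun_prop) (by fun_prop))]
  congr 1
  ext z
  simp

lemma integrable_exceedProb_mul (h b : ℝ) {v : ℝ → ℝ} (hv : Integrable v) :
    Integrable fun x ↦ exceedProb h b x * v x :=
  hv.bdd_mul (c := 1) (exceedProb_mono h b).measurable.aestronglyMeasurable
    (ae_of_all _ fun x ↦ by
      rw [Real.norm_eq_abs, abs_of_nonneg (exceedProb_nonneg h b x)]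
      exact exceedProb_le_one h b x)

lemma exceedProb_le_exp {h a b C : ℝ} (hh : 0 < h) (hab : |a - b| ≤ C * √h) (x : ℝ) :
    exceedProb h b x ≤ rexp (C + 1 / 2) * rexp ((x - a) / √h) := by
  have hs : 0 < √h := Real.sqrt_pos.2 hh
  have h1 : exceedProb h b x ≤ (gaussianReal 0 1).real {z | (a - x) / √h - C ≤ id z} := by
    refine measureReal_mono fun z (hz : b < x + √h * z) ↦ ?_
    show (a - x) / √h - C ≤ z
    rw [sub_le_iff_le_add, div_le_iff₀ hs]
    have := le_abs_self (a - b)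
    linarith
  refine h1.trans ((measure_ge_le_exp_mul_mgf (t := 1) _ zero_le_one ?_).trans_eq ?_)
  · exact integrable_exp_mul_gaussianReal 1
  · rw [mgf_id_gaussianReal, ← Real.exp_add, ← Real.exp_add]
    congr 1
    push_cast
    ring

lemma integral_exceedProb_mul_le {h a b C M : ℝ} (hh : 0 < h) (hab : |a - b| ≤ C * √h)
    {v : ℝ → ℝ} (hv : Integrable v) (hv0 : ∀ x, 0 ≤ v x) (hvM : ∀ x, v x ≤ M) :
    ∫ x in Iic a, exceedProb h b x * v x ≤ M * rexp (C + 1 / 2) * √h := by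
  have hs : 0 < √h := Real.sqrt_pos.2 hh
  have hexp : ∀ x, rexp ((x - a) / √h) = rexp (-a / √h) * rexp ((√h)⁻¹ * x) := fun x ↦ by
    rw [← Real.exp_add]; congr 1; field_simp; ring
  have hpos : 0 < (√h)⁻¹ := inv_pos.2 hs
  calc ∫ x in Iic a, exceedProb h b x * v x
      ≤ ∫ x in Iic a, rexp (C + 1 / 2) * M * rexp (-a / √h) * rexp ((√h)⁻¹ * x) := by
        refine integral_mono (integrable_exceedProb_mul h b hv).integrableOn
          ((integrableOn_exp_mul_Iic hpos a).const_mul _) fun x ↦ ?_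
        calc exceedProb h b x * v x
            ≤ (rexp (C + 1 / 2) * rexp ((x - a) / √h)) * M :=
              mul_le_mul (exceedProb_le_exp hh hab x) (hvM x) (hv0 x) (by positivity)
          _ = _ := by rw [hexp]; ring
    _ = M * rexp (C + 1 / 2) * √h := by
        rw [integral_const_mul, integral_exp_mul_Iic hpos, div_inv_eq_mul]
        have : rexp (-a / √h) * rexp ((√h)⁻¹ * a) = 1 := by
          rw [← Real.exp_add]; simp; field_simp; ring
        linear_combination (M * rexp (C + 1 / 2) * √h) * this

lemma le_integral_exceedProb_mul {h a b C k δ : ℝ} (hh : 0 < h) (hab : |a - b| ≤ C * √h)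
    (hδ : 0 < δ) (hk : 0 ≤ k) {v : ℝ → ℝ} (hv : Integrable v) (hv0 : ∀ x, 0 ≤ v x)
    (hvk : ∀ x, |x - a| ≤ δ → k ≤ v x) :
    (gaussianReal 0 1).real (Ioi (C + 1)) * k * min δ √h
      ≤ ∫ x in Iic a, exceedProb h b x * v x := by
  have hs : 0 < √h := Real.sqrt_pos.2 hh
  have hr : 0 < min δ √h := lt_min hδ hs
  have := mul_sub_le_setIntegral (S := Iic a) (integrable_exceedProb_mul h b hv).integrableOn
    (fun x ↦ mul_nonneg (exceedProb_nonneg h b x) (hv0 x))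
    (k := (gaussianReal 0 1).real (Ioi (C + 1)) * k) (c := a - min δ √h) (d := a)
    (by linarith) (fun x hx ↦ hx.2) (fun x hx ↦ ?_)
  · simpa using this
  have h1 := hx.1
  have h2 := hx.2
  have h3 := min_le_left δ √h
  have h4 := min_le_right δ √h
  refine mul_le_mul ?_ (hvk x ?_) hk (exceedProb_nonneg h b x)
  · refine measureReal_mono fun z (hz : C + 1 < z) ↦ ?_
    show b < x + √h * z
    have h5 := neg_abs_le (a - b)
    nlinarith
  · rw [abs_of_nonpos (by linarith)]; linarith

lemma SchwartzMap.exists_lipschitz_bound (f : SchwartzMap ℝ ℝ) :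
    ∃ L > 0, ∃ M > 0, (∀ x y, |f x - f y| ≤ L * |x - y|) ∧ ∀ x, |f x| ≤ M := by
  obtain ⟨K, hK⟩ : ∃ K, ∀ x, ‖deriv f x‖ ≤ K :=
    ⟨_, fun x ↦ by simpa using (SchwartzMap.derivCLM ℝ ℝ f).norm_le_seminorm ℝ x⟩
  refine ⟨|K| + 1, by positivity, SchwartzMap.seminorm ℝ 0 0 f + 1, by positivity,
    fun x y ↦ ?_, fun x ↦ ?_⟩
  · have := Convex.norm_image_sub_le_of_norm_deriv_le (𝕜 := ℝ) (f := f) (s := univ)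
      (fun z _ ↦ f.differentiableAt) (fun z _ ↦ hK z) convex_univ (mem_univ y) (mem_univ x)
    rw [Real.norm_eq_abs, Real.norm_eq_abs] at this
    refine this.trans (mul_le_mul_of_nonneg_right ?_ (abs_nonneg _))
    linarith [le_abs_self K]
  · have := f.norm_le_seminorm ℝ x
    rw [Real.norm_eq_abs] at this
    linarith

section Quantile

variable {f : ℝ → ℝ} {q : ℝ → ℝ} {α L M m : ℝ}

/-- Wherever the density at the quantile is at least `m`, the quantile is locally
`1/2`-Hölder. -/
lemma mul_min_quantile_le (hf : Continuous f) (hfi : Integrable f) (hf0 : ∀ x, 0 ≤ f x)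
    (hL : 0 < L) (hM : ∀ x, |f x| ≤ M) (hlip : ∀ x y, |f x - f y| ≤ L * |x - y|)
    (hq : ∀ t, 0 ≤ t → ∫ x in Iic (q t), udens f x t = α) (hm : 0 < m)
    {s t : ℝ} (hs : 0 ≤ s) (ht : 0 ≤ t) (hqt : m ≤ udens f (q t) t) :
    m / 2 * min |q s - q t| (m / (2 * L)) ≤ M * √|t - s| := by
  have h1 := mul_min_le_abs_cdf_sub hL hm (integrable_udens hf hfi ht)
    (fun x ↦ udens_nonneg hf hf0 x ht)
    (fun x y ↦ by simpa using abs_udens_sub_le hL.le hf hM hlip x y ht ht) hqt (q s)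
  have h2 := abs_setIntegral_udens_sub_le hf hfi hf0 (fun x ↦ (le_abs_self _).trans (hM x))
    (q s) hs ht
  rw [hq s hs] at h2
  rw [hq t ht] at h1
  exact h1.trans h2

lemma continuousOn_quantile_s5 (hf : Continuous f) (hfi : Integrable f) (hf0 : ∀ x, 0 ≤ f x)
    (hL : 0 < L) (hM : ∀ x, |f x| ≤ M) (hlip : ∀ x y, |f x - f y| ≤ L * |x - y|)
    (hq : ∀ t, 0 ≤ t → ∫ x in Iic (q t), udens f x t = α)
    (hpos : ∀ t, 0 ≤ t → 0 < udens f (q t) t) : ContinuousOn q (Ici 0) := by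
  intro t ht
  have hm := hpos t ht
  set m := udens f (q t) t with hm_def
  have hδ : 0 < m / (2 * L) := by positivity
  rw [ContinuousWithinAt, Metric.tendsto_nhds]
  intro ε hε
  have hlim : Tendsto (fun s ↦ M * √|t - s|) (nhdsWithin t (Ici 0)) (nhds 0) := by
    have : Continuous fun s ↦ M * √|t - s| := by fun_prop
    simpa using (this.tendsto t).mono_left nhdsWithin_le_nhds
  have hr : 0 < m / 2 * min ε (m / (2 * L)) := by positivity
  filter_upwards [hlim.eventually_lt_const hr, self_mem_nhdsWithin] with s hs1 hs0
  have h1 := mul_min_quantile_le hf hfi hf0 hL hM hlip hq hm hs0 ht hm_def.le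
  have h2 := lt_of_mul_lt_mul_left (h1.trans_lt hs1) (by positivity)
  rw [Real.dist_eq]
  by_contra! h3
  exact absurd h2 (not_lt.2 (min_le_min_right _ h3))

lemma exists_density_lower_bound_and_quantile_holder (hf : Continuous f) (hfi : Integrable f)
    (hf0 : ∀ x, 0 ≤ f x) (hL : 0 < L) (hM : ∀ x, |f x| ≤ M)
    (hlip : ∀ x y, |f x - f y| ≤ L * |x - y|)
    (hq : ∀ t, 0 ≤ t → ∫ x in Iic (q t), udens f x t = α)
    (hpos : ∀ t, 0 ≤ t → 0 < udens f (q t) t) {T : ℝ} (hT : 0 ≤ T) :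
    ∃ m > 0, ∃ C > 0, (∀ t ∈ Icc 0 T, m ≤ udens f (q t) t) ∧
      ∀ s ∈ Icc 0 T, ∀ t ∈ Icc 0 T, |q s - q t| ≤ C * √|t - s| := by
  have hM0 : 0 ≤ M := (abs_nonneg _).trans (hM 0)
  have hqc : ContinuousOn q (Icc 0 T) :=
    (continuousOn_quantile_s5 hf hfi hf0 hL hM hlip hq hpos).mono Icc_subset_Ici_self
  have huc : ContinuousOn (fun t ↦ udens f (q t) t) (Icc 0 T) := by
    intro t ht
    rw [ContinuousWithinAt, tendsto_iff_dist_tendsto_zero]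
    have hlim : Tendsto (fun s ↦ L * (|q s - q t| + √|s - t|)) (nhdsWithin t (Icc 0 T))
        (nhds 0) := by
      have h1 : ContinuousWithinAt (fun s ↦ L * (|q s - q t| + √|s - t|)) (Icc 0 T) t :=
        (((hqc t ht).sub continuousWithinAt_const).abs.add
          (by fun_prop : Continuous fun s ↦ √|s - t|).continuousWithinAt).const_mul L
      simpa [ContinuousWithinAt] using h1
    refine squeeze_zero' (Eventually.of_forall fun s ↦ dist_nonneg) ?_ hlim
    filter_upwards [self_mem_nhdsWithin] with s hs
    exact abs_udens_sub_le hL.le hf hM hlip _ _ ht.1 hs.1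
  have hne : (Icc (0 : ℝ) T).Nonempty := nonempty_Icc.2 hT
  obtain ⟨t₀, ht₀, hmin⟩ := isCompact_Icc.exists_isMinOn hne huc
  obtain ⟨R, hR⟩ := isCompact_Icc.exists_bound_of_continuousOn hqc
  have hR0 : 0 ≤ R := (norm_nonneg _).trans (hR 0 ⟨le_rfl, hT⟩)
  have hm := hpos t₀ ht₀.1
  set m := udens f (q t₀) t₀
  set δ := m / (2 * L) with hδ_def
  have hδ : 0 < δ := by positivity
  refine ⟨m, hm, (2 * R + δ) / δ * (2 * M / m) + 1, by positivity, fun t ht ↦ hmin ht,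
    fun s hs t ht ↦ ?_⟩
  have h1 := mul_min_quantile_le hf hfi hf0 hL hM hlip hq hm hs.1 ht.1 (hmin ht)
  rw [← hδ_def] at h1
  have h2 : |q s - q t| ≤ 2 * R := by
    have h3 := hR s hs
    have h4 := hR t ht
    rw [Real.norm_eq_abs] at h3 h4
    linarith [abs_sub (q s) (q t)]
  have h3 : δ / (2 * R + δ) * |q s - q t| ≤ min |q s - q t| δ := by
    refine le_min (mul_le_of_le_one_left (abs_nonneg _) ?_) ?_
    · rw [div_le_one (by positivity)]; linarith
    · rw [div_mul_eq_mul_div, div_le_iff₀ (by positivity)]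
      exact mul_le_mul_of_nonneg_left (by linarith) hδ.le
  calc |q s - q t|
      = (2 * R + δ) / δ * (2 / m) * (m / 2 * (δ / (2 * R + δ) * |q s - q t|)) := by
        field_simp
    _ ≤ (2 * R + δ) / δ * (2 / m) * (M * √|t - s|) := by
        refine mul_le_mul_of_nonneg_left (le_trans ?_ h1) (by positivity)
        exact mul_le_mul_of_nonneg_left h3 (by positivity)
    _ ≤ _ := by
        have := Real.sqrt_nonneg |t - s|
        have e : (2 * R + δ) / δ * (2 / m) * (M * √|t - s|)
          = (2 * R + δ) / δ * (2 * M / m) * √|t - s| := by ring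
        rw [e]
        linarith

end Quantile

/-- On `[0,T]`, `E|F(t) − F(s)|² = ρ(t,t) + ρ(s,s) − 2ρ(s,t)` is bounded above
and below by constant multiples of `|t−s|^{1/2}`. -/
theorem variance_increment_order
    {Ω : Type*} [MeasurableSpace Ω] (P : Measure Ω) [IsProbabilityMeasure P]
    (f : SchwartzMap ℝ ℝ) (hf_nonneg : ∀ x, 0 ≤ f x) (hf_prob : ∫ x : ℝ, f x = 1)
    (α : ℝ) (hα : α ∈ Set.Ioo (0 : ℝ) 1)
    (q : ℝ → ℝ)
    (hq : ∀ t, 0 ≤ t → ∫ x in Set.Iic (q t), udens (⇑f) x t = α)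
    (hq_unique : ∀ t, 0 ≤ t → ∀ r : ℝ, (∫ x in Set.Iic r, udens (⇑f) x t = α) → r = q t)
    (hfq0 : 0 < f (q 0))
    (B : ℝ → Ω → ℝ) (hB_meas : ∀ t, Measurable (B t))
    (hBmarg : ∀ t, 0 ≤ t → ∀ a : ℝ,
      (P {ω | B t ω ≤ a}).toReal = ∫ x in Set.Iic a, udens (⇑f) x t)
    (hBjoint : ∀ s t : ℝ, 0 ≤ s → s < t → ∀ a b : ℝ,
      (P {ω | B s ω ≤ a ∧ B t ω ≤ b}).toReal
        = ∫ x in Set.Iic a, (∫ y in Set.Iic b, heatKernel (t - s) x y) * udens (⇑f) x s)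
    (T : ℝ) (hT : 0 < T) :
    ∃ C₁ > (0 : ℝ), ∃ C₂ > (0 : ℝ), ∀ s ∈ Set.Icc (0 : ℝ) T, ∀ t ∈ Set.Icc (0 : ℝ) T,
      C₁ * |t - s| ^ ((1 : ℝ) / 2)
          ≤ rho P B (⇑f) q α t t + rho P B (⇑f) q α s s - 2 * rho P B (⇑f) q α s t ∧
        rho P B (⇑f) q α t t + rho P B (⇑f) q α s s - 2 * rho P B (⇑f) q α s t
          ≤ C₂ * |t - s| ^ ((1 : ℝ) / 2) := by
  have hfc : Continuous f := f.continuous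
  have hfi : Integrable f := f.integrable
  obtain ⟨L, hL, M, hM0, hlip, hM⟩ := f.exists_lipschitz_bound
  have hpos : ∀ t, 0 ≤ t → 0 < udens f (q t) t := by
    intro t ht
    rcases ht.eq_or_lt with rfl | ht
    · simpa [udens] using hfq0
    · exact udens_pos hfc hf_nonneg hM hfq0.ne' _ ht
  obtain ⟨m, hm, C, hC, hmg, hqC⟩ := exists_density_lower_bound_and_quantile_holder hfc hfi
    hf_nonneg hL hM hlip hq hpos hT.le
  have hgM : ∀ t ∈ Icc 0 T, udens f (q t) t ≤ M := fun t ht ↦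
    udens_le hfc hf_nonneg (fun x ↦ (le_abs_self _).trans (hM x)) _ ht.1
  set c := (gaussianReal 0 1).real (Ioi (C + 1)) with hc_def
  have hc : 0 < c :=
    ENNReal.toReal_pos (isOpen_Ioi.measure_pos _ nonempty_Ioi).ne' (measure_ne_top _ _)
  set δ := m / (2 * L) with hδ_def
  have hδ : 0 < δ := by positivity
  have hsT : 0 < √T := Real.sqrt_pos.2 hT
  have hα' : 0 < α - α ^ 2 := by nlinarith [hα.1, hα.2]
  set c₁ := 2 * (c * (m / 2) * min (δ / √T) 1) / M ^ 2 with hc₁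
  set c₂ := (α - α ^ 2) * ((L * (C + 1)) ^ 2 * √T / m ^ 4) + 2 * (M * rexp (C + 1 / 2)) / m ^ 2
    with hc₂
  have key : ∀ s ∈ Icc (0 : ℝ) T, ∀ t ∈ Icc (0 : ℝ) T, s < t →
      c₁ * √|t - s| ≤ rho P B f q α t t + rho P B f q α s s - 2 * rho P B f q α s t ∧
        rho P B f q α t t + rho P B f q α s s - 2 * rho P B f q α s t ≤ c₂ * √|t - s| := by
    intro s hs t ht hst
    have hh : 0 < t - s := sub_pos.2 hst
    have hsh : 0 < √(t - s) := Real.sqrt_pos.2 hh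
    rw [abs_of_pos hh]
    have hui := integrable_udens hfc hfi hs.1
    have hu0 := fun x ↦ udens_nonneg hfc hf_nonneg x hs.1
    have hqst : |q s - q t| ≤ C * √(t - s) := by
      simpa only [abs_of_pos hh] using hqC s hs t ht
    set D := ∫ x in Iic (q s), exceedProb (t - s) (q t) x * udens f x s with hD
    have hDle : D ≤ M * rexp (C + 1 / 2) * √(t - s) :=
      integral_exceedProb_mul_le hh hqst hui hu0 fun x ↦
        udens_le hfc hf_nonneg (fun y ↦ (le_abs_self _).trans (hM y)) _ hs.1
    have hleD : c * (m / 2) * min δ √(t - s) ≤ D := by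
      refine le_integral_exceedProb_mul hh hqst hδ (by positivity) hui hu0 fun x hx ↦ ?_
      have h1 := abs_udens_sub_le hL.le hfc hM hlip x (q s) hs.1 hs.1
      have h2 : L * |x - q s| ≤ m / 2 := by
        calc L * |x - q s| ≤ L * δ := by gcongr
          _ = m / 2 := by rw [hδ_def]; field_simp
      have h3 := neg_abs_le (udens f x s - udens f (q s) s)
      have h4 := hmg s hs
      simp only [sub_self, abs_zero, Real.sqrt_zero, add_zero] at h1
      linarith
    have hmin : min (δ / √T) 1 * √(t - s) ≤ min δ √(t - s) := by
      have h1 : √(t - s) ≤ √T := Real.sqrt_le_sqrt (by linarith [hs.1, ht.2])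
      refine le_min ?_ (mul_le_of_le_one_left hsh.le (min_le_right _ _))
      calc min (δ / √T) 1 * √(t - s) ≤ δ / √T * √T :=
            mul_le_mul (min_le_left _ _) h1 hsh.le (by positivity)
        _ = δ := div_mul_cancel₀ _ hsT.ne'
    have hJ : (P {ω | B s ω ≤ q s ∧ B t ω ≤ q t}).toReal = α - D := by
      rw [hBjoint s t hs.1 hst, ← hq s hs.1, hD, ← integral_sub hui.integrableOn
        (integrable_exceedProb_mul _ _ hui).integrableOn]
      congr with x
      rw [setIntegral_heatKernel_eq_one_sub hh]
      ring
    have hdiag : ∀ r, 0 ≤ r → (P {ω | B r ω ≤ q r ∧ B r ω ≤ q r}).toReal = α := by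
      intro r hr
      simp only [and_self]
      rw [hBmarg r hr, hq r hr]
    have hgs := hmg s hs
    have hgt := hmg t ht
    have hgs' := hgM s hs
    have hgt' := hgM t ht
    have hgd : |udens f (q s) s - udens f (q t) t| ≤ L * (C + 1) * √(t - s) := by
      have h1 := abs_udens_sub_le hL.le hfc hM hlip (q s) (q t) ht.1 hs.1
      rw [abs_sub_comm s t, abs_of_pos hh] at h1
      refine h1.trans ?_
      rw [mul_assoc]
      gcongr
      linarith
    simp only [rho, hJ, hdiag s hs.1, hdiag t ht.1]
    set g := udens f (q s) s
    set k := udens f (q t) t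
    have hg : 0 < g := hm.trans_le hgs
    have hk : 0 < k := hm.trans_le hgt
    have hV : (α - α ^ 2) / (k * k) + (α - α ^ 2) / (g * g) - 2 * ((α - D - α ^ 2) / (g * k))
        = (α - α ^ 2) * ((g - k) ^ 2 / (g * k) ^ 2) + 2 * D / (g * k) := by
      field_simp
      ring
    have hD0 : 0 ≤ D := le_trans (by positivity) hleD
    have hgk : m ^ 2 ≤ g * k := by rw [sq]; exact mul_le_mul hgs hgt hm.le hg.le
    have hgk' : g * k ≤ M ^ 2 := by rw [sq]; exact mul_le_mul hgs' hgt' hk.le hM0.le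
    rw [hV]
    constructor
    · have h1 : 0 ≤ (α - α ^ 2) * ((g - k) ^ 2 / (g * k) ^ 2) := by positivity
      have h2 : c₁ * √(t - s) ≤ 2 * D / (g * k) := by
        calc c₁ * √(t - s)
            = 2 * (c * (m / 2) * (min (δ / √T) 1 * √(t - s))) / M ^ 2 := by rw [hc₁]; ring
          _ ≤ 2 * D / M ^ 2 := by
            gcongr
            exact le_trans (by gcongr) hleD
          _ ≤ 2 * D / (g * k) := by gcongr
      linarith
    · have h1 : (g - k) ^ 2 ≤ (L * (C + 1)) ^ 2 * √T * √(t - s) := by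
        calc (g - k) ^ 2 = |g - k| ^ 2 := (sq_abs _).symm
          _ ≤ (L * (C + 1) * √(t - s)) ^ 2 := by gcongr
          _ = (L * (C + 1)) ^ 2 * √(t - s) * √(t - s) := by ring
          _ ≤ _ := by
            gcongr
            linarith [hs.1, ht.2]
      calc _ ≤ (α - α ^ 2) * ((L * (C + 1)) ^ 2 * √T * √(t - s) / (m ^ 2) ^ 2)
              + 2 * (M * rexp (C + 1 / 2) * √(t - s)) / m ^ 2 := by gcongr
        _ = c₂ * √(t - s) := by rw [hc₂]; ring
  have hrho : ∀ s t, rho P B f q α s t = rho P B f q α t s := fun s t ↦ by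
    simp only [rho, and_comm, mul_comm]
  refine ⟨c₁, by positivity, c₂, by positivity, fun s hs t ht ↦ ?_⟩
  rw [← Real.sqrt_eq_rpow]
  rcases lt_trichotomy s t with h | rfl | h
  · exact key s hs t ht h
  · simp only [sub_self, abs_zero, Real.sqrt_zero, mul_zero]
    constructor <;> linarith
  · have := key t ht s hs h
    rw [abs_sub_comm, hrho t s, add_comm (rho P B f q α s s)] at this
    exact this
end
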